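/- Assume k is algebraically closed. For g, g' ∈ GL(a+b,k): (1) K·g·P(d*) = K·g'·P(d*) if and only if U_v(g) = U_v(g') and L_v(g) = L_v(g') for every column label v, and B_{v,w}(g) = B_{v,w}(g') for every pair of labels v < w; (2) Zcl(K·g·P(d*)) ∩ GL(a+b,k) ⊆ Zcl(K·g'·P(d*)) if and only if U_v(g) ≤ U_v(g') and L_v(g) ≤ L_v(g') for every label v, and B_{v,w}(g) ≤ B_{v,w}(g') for every v < w. -/

import Mathlib

open Matrix

/-! Statement 13: `P(d*)`-orbits and orbit closures in `K\GL(a+b)` are determined by the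
rank functions `U_v`, `L_v`, `B_{v,w}`.

Dimension data for the quiver `Q*(n)`: `dx i = d*(x_i)` (`0 ≤ i ≤ n`), `dy0 = d*(y₀)`,
`dy0' = d*(y₀')`, `dy i = d*(y_{i+1})` (`0 ≤ i ≤ n-1`). -/

/-- Partial sums `psum f m = f 0 + ⋯ + f (m-1)`. -/
def psum (f : ℕ → ℕ) (m : ℕ) : ℕ := ∑ i ∈ Finset.range m, f i

/-- `d*_x`. -/
def dXt (dx : ℕ → ℕ) (n : ℕ) : ℕ := psum dx (n + 1)

/-- `d*_y`. -/
def dYt (dy : ℕ → ℕ) (n : ℕ) : ℕ := psum dy n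

/-- `a = d*(y₀) + d*_y + d*_x`. -/
def aD (n : ℕ) (dx dy : ℕ → ℕ) (dy0 : ℕ) : ℕ := dy0 + dYt dy n + dXt dx n

/-- `b = d*(y₀') + d*_y + d*_x`. -/
def bD (n : ℕ) (dx dy : ℕ → ℕ) (dy0' : ℕ) : ℕ := dy0' + dYt dy n + dXt dx n

/-- `a + b`. -/
def NN (n : ℕ) (dx dy : ℕ → ℕ) (dy0 dy0' : ℕ) : ℕ :=
  aD n dx dy dy0 + bD n dx dy dy0'

/-- The subgroup `K = diag(GL(a), GL(b))` as a set of matrices. -/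
def kDiag (k : Type) [Field k] (n : ℕ) (dx dy : ℕ → ℕ) (dy0 dy0' : ℕ) :
    Set (Matrix (Fin (NN n dx dy dy0 dy0')) (Fin (NN n dx dy dy0 dy0')) k) :=
  {g | IsUnit g ∧ ∀ i c : Fin (NN n dx dy dy0 dy0'),
    (((i : ℕ) < aD n dx dy dy0 ∧ aD n dx dy dy0 ≤ (c : ℕ)) ∨
      (aD n dx dy dy0 ≤ (i : ℕ) ∧ (c : ℕ) < aD n dx dy dy0)) → g i c = 0}

/-- `x` is a boundary of the partition of `a+b` into consecutive blocks of sizes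
`d*(x_n), …, d*(x₀), d*(x₀), …, d*(x_n), d*(y_n), …, d*(y₁), d*(y₀)+d*(y₀'),
d*(y₁), …, d*(y_n)` (the blocks being labelled, in order,
`x_n,…,x₀,x₀ˢ,…,x_nˢ,y_n,…,y₁,(y₀+y₀'),y₁ˢ,…,y_nˢ`). -/
def isCut (n : ℕ) (dx dy : ℕ → ℕ) (dy0 dy0' : ℕ) (x : ℕ) : Prop :=
  (∃ m ≤ n + 1, x = dXt dx n - psum dx m) ∨
  (∃ m ≤ n + 1, x = dXt dx n + psum dx m) ∨
  (∃ m ≤ n, x = 2 * dXt dx n + dYt dy n - psum dy m) ∨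
  x = 2 * dXt dx n + dYt dy n + dy0 + dy0' ∨
  (∃ m ≤ n, x = 2 * dXt dx n + dYt dy n + dy0 + dy0' + psum dy m)

/-- The parabolic subgroup `P(d*)` of block upper triangular invertible matrices. -/
def pPara (k : Type) [Field k] (n : ℕ) (dx dy : ℕ → ℕ) (dy0 dy0' : ℕ) :
    Set (Matrix (Fin (NN n dx dy dy0 dy0')) (Fin (NN n dx dy dy0 dy0')) k) :=
  {g | IsUnit g ∧ ∀ i c : Fin (NN n dx dy dy0 dy0'),
    (∃ x : ℕ, isCut n dx dy dy0 dy0' x ∧ (c : ℕ) < x ∧ x ≤ (i : ℕ)) → g i c = 0}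

/-- The orbit `K·g·P(d*)` as a set of matrices. -/
def orbitKP (k : Type) [Field k] (n : ℕ) (dx dy : ℕ → ℕ) (dy0 dy0' : ℕ)
    (g : Matrix (Fin (NN n dx dy dy0 dy0')) (Fin (NN n dx dy dy0 dy0')) k) :
    Set (Matrix (Fin (NN n dx dy dy0 dy0')) (Fin (NN n dx dy dy0 dy0')) k) :=
  {x | ∃ κ ∈ kDiag k n dx dy dy0 dy0', ∃ π ∈ pPara k n dx dy dy0 dy0', x = κ * g * π}

/-- The size of the `m`-th block (`0 ≤ m < 4n+3`) in the column partition, the blocks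
being labelled `x_n,…,x₀,x₀ˢ,…,x_nˢ,y_n,…,y₁,(y₀+y₀'),y₁ˢ,…,y_nˢ` in order. -/
def blkSize (n : ℕ) (dx dy : ℕ → ℕ) (dy0 dy0' : ℕ) (m : ℕ) : ℕ :=
  if m < n + 1 then dx (n - m)
  else if m < 2 * n + 2 then dx (m - (n + 1))
  else if m < 3 * n + 2 then dy (n - 1 - (m - (2 * n + 2)))
  else if m = 3 * n + 2 then dy0 + dy0'
  else dy (m - (3 * n + 3))

/-- `eCut v` is the last column position (exclusive) of the block labelled `v`; i.e. the
columns lying in blocks with label `≤ v` are exactly those `< eCut v`. -/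
def eCut (n : ℕ) (dx dy : ℕ → ℕ) (dy0 dy0' : ℕ) (v : ℕ) : ℕ :=
  ∑ m ∈ Finset.range (v + 1), blkSize n dx dy dy0 dy0' m

/-- Entry extraction by natural number indices (with junk value `0` out of range). -/
def ent {k : Type} [Field k] {N : ℕ} (g : Matrix (Fin N) (Fin N) k) (i c : ℕ) : k :=
  if h : i < N ∧ c < N then g ⟨i, h.1⟩ ⟨c, h.2⟩ else 0

/-- `U_v(g)`: the rank of the submatrix of the top `a` rows of `g` on the columns lying
in blocks with label `≤ v`. -/
noncomputable def Urk (k : Type) [Field k] (n : ℕ) (dx dy : ℕ → ℕ) (dy0 dy0' : ℕ)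
    (g : Matrix (Fin (NN n dx dy dy0 dy0')) (Fin (NN n dx dy dy0 dy0')) k) (v : ℕ) : ℕ :=
  (Matrix.of fun (i : Fin (aD n dx dy dy0)) (c : Fin (eCut n dx dy dy0 dy0' v)) =>
    ent g (i : ℕ) (c : ℕ)).rank

/-- `L_v(g)`: the analogous rank for the bottom `b` rows of `g`. -/
noncomputable def Lrk (k : Type) [Field k] (n : ℕ) (dx dy : ℕ → ℕ) (dy0 dy0' : ℕ)
    (g : Matrix (Fin (NN n dx dy dy0 dy0')) (Fin (NN n dx dy dy0 dy0')) k) (v : ℕ) : ℕ :=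
  (Matrix.of fun (i : Fin (bD n dx dy dy0')) (c : Fin (eCut n dx dy dy0 dy0' v)) =>
    ent g (aD n dx dy dy0 + (i : ℕ)) (c : ℕ)).rank

/-- `B_{v,w}(g)`: the rank of the block matrix
`[[M_{≤v}, 0, M_{(v,w]}], [0, N_{≤v}, N_{(v,w]}]]`, where `M` (resp. `N`) is the top `a`
(resp. bottom `b`) rows of `g`. -/
noncomputable def Brk (k : Type) [Field k] (n : ℕ) (dx dy : ℕ → ℕ) (dy0 dy0' : ℕ)
    (g : Matrix (Fin (NN n dx dy dy0 dy0')) (Fin (NN n dx dy dy0 dy0')) k) (v w : ℕ) : ℕ :=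
  (Matrix.of fun (i : Fin (NN n dx dy dy0 dy0'))
      (c : Fin (eCut n dx dy dy0 dy0' v + eCut n dx dy dy0 dy0' v +
        (eCut n dx dy dy0 dy0' w - eCut n dx dy dy0 dy0' v))) =>
    if (c : ℕ) < eCut n dx dy dy0 dy0' v then
      (if (i : ℕ) < aD n dx dy dy0 then ent g (i : ℕ) (c : ℕ) else 0)
    else if (c : ℕ) < eCut n dx dy dy0 dy0' v + eCut n dx dy dy0 dy0' v then
      (if aD n dx dy dy0 ≤ (i : ℕ) then
        ent g (i : ℕ) ((c : ℕ) - eCut n dx dy dy0 dy0' v) else 0)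
    else ent g (i : ℕ) ((c : ℕ) - eCut n dx dy dy0 dy0' v)).rank

/-- The Zariski closure of a set of `N × N` matrices: all matrices on which every
polynomial function of the entries vanishing identically on `T` vanishes. -/
def Zcl {k : Type} [Field k] {N : ℕ} (T : Set (Matrix (Fin N) (Fin N) k)) :
    Set (Matrix (Fin N) (Fin N) k) :=
  {x | ∀ f : MvPolynomial (Fin N × Fin N) k,
    (∀ y ∈ T, MvPolynomial.eval (fun pr => y pr.1 pr.2) f = 0) →
    MvPolynomial.eval (fun pr => x pr.1 pr.2) f = 0}

set_option linter.unusedSimpArgs false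
set_option linter.unusedVariables false
namespace Cl

inductive Ty : Type
  | sgn (s : Bool) (i : ℕ) : Ty
  | pair (i j : ℕ) : Ty

noncomputable instance : DecidableEq Ty := Classical.decEq Ty

open Ty

def tD (v : ℕ) : Ty → ℤ
  | sgn _ i => if i ≤ v then 1 else 0
  | pair i j => (if i ≤ v then 1 else 0) + (if j ≤ v then 1 else 0)

def tR (s : Bool) (v : ℕ) : Ty → ℤ
  | sgn s' i => if s' = s ∧ i ≤ v then 1 else 0
  | pair i _ => if i ≤ v then 1 else 0

def tC (v w : ℕ) : Ty → ℤ
  | sgn _ _ => 0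
  | pair i j => if i ≤ v ∧ w < j then 1 else 0

def S (f : Ty → ℤ) (L : Multiset Ty) : ℤ := (L.map f).sum

@[simp] lemma S_zero (f : Ty → ℤ) : S f 0 = 0 := by simp [S]
@[simp] lemma S_cons (f : Ty → ℤ) (x : Ty) (L) : S f (x ::ₘ L) = f x + S f L := by simp [S]
@[simp] lemma S_add (f : Ty → ℤ) (L M) : S f (L + M) = S f L + S f M := by simp [S]
@[simp] lemma S_single (f : Ty → ℤ) (x : Ty) : S f {x} = f x := by simp [S]
lemma S_insert (f : Ty → ℤ) (x : Ty) (L : Multiset Ty) : S f (insert x L) = f x + S f L := by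
  simp [S]

lemma S_nonneg (f : Ty → ℤ) (L) (h : ∀ x ∈ L, 0 ≤ f x) : 0 ≤ S f L := by
  induction L using Multiset.induction with
  | empty => simp
  | cons a s ih =>
    have h1 := h a (by simp)
    have h2 := ih (fun x hx => h x (by simp [hx]))
    simp; omega

lemma S_nonpos (f : Ty → ℤ) (L) (h : ∀ x ∈ L, f x ≤ 0) : S f L ≤ 0 := by
  induction L using Multiset.induction with
  | empty => simp
  | cons a s ih =>
    have h1 := h a (by simp)
    have h2 := ih (fun x hx => h x (by simp [hx]))
    simp; omega

lemma S_nonpos' (f : Ty → ℤ) (L) (h : ∀ x ∈ L, f x ≤ 0) (x0) (hx : x0 ∈ L) (h0 : f x0 ≤ -1) :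
    S f L ≤ -1 := by
  obtain ⟨R, rfl⟩ := Multiset.exists_cons_of_mem hx
  have := S_nonpos f R (fun x hx => h x (by simp [hx]))
  simp; omega

lemma S_sub (f g : Ty → ℤ) (L) : S (fun x => f x - g x) L = S f L - S g L := by
  simp [S]

lemma exists_of_S_pos (f : Ty → ℤ) (L) (h : 0 < S f L) : ∃ x ∈ L, 0 < f x := by
  by_contra hc
  push Not at hc
  have := S_nonpos f L hc
  omega

lemma S_pos (f : Ty → ℤ) (L) (h : ∀ x ∈ L, 0 ≤ f x) (x0) (hx : x0 ∈ L) (h0 : 1 ≤ f x0) :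
    1 ≤ S f L := by
  obtain ⟨R, rfl⟩ := Multiset.exists_cons_of_mem hx
  have := S_nonneg f R (fun x hx => h x (by simp [hx]))
  simp; omega

def Valid (L : Multiset Ty) : Prop := ∀ i j, pair i j ∈ L → i < j

structure Le (L L' : Multiset Ty) : Prop where
  D : ∀ v, S (tD v) L = S (tD v) L'
  R : ∀ s v, S (tR s v) L ≤ S (tR s v) L'
  C : ∀ v w, v ≤ w → S (tC v w) L ≤ S (tC v w) L'

lemma Le.refl (L) : Le L L := ⟨fun _ => rfl, fun _ _ => le_rfl, fun _ _ _ => le_rfl⟩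

/-- Elementary degenerations. -/
inductive Mv : Multiset Ty → Multiset Ty → Prop
  | m1 (s : Bool) (i l : ℕ) (h : i < l) : Mv {pair i l} {sgn s i, sgn (!s) l}
  | m2 (s : Bool) (i k l : ℕ) (h : i < k) (h' : k < l) :
      Mv {pair i l, sgn s k} {pair i k, sgn s l}
  | m2' (s : Bool) (i k l : ℕ) (h : i < k) (h' : k < l) :
      Mv {pair i l, sgn s k} {pair k l, sgn s i}
  | m3 (i h j l : ℕ) (h1 : i < h) (h2 : h < j) (h3 : j < l) :
      Mv {pair i l, pair h j} {pair i j, pair h l}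
  | m4 (s : Bool) (i t k l : ℕ) (h1 : i < t) (h2 : t ≤ k) (h3 : k < l) :
      Mv {pair i l, sgn s t, sgn (!s) k} {pair i t, pair k l}
  | m5 (i h l r : ℕ) (h1 : i < h) (h2 : h < l) (h3 : l < r) :
      Mv {pair i l, pair h r} {pair i h, pair l r}

def Step (L L' : Multiset Ty) : Prop := ∃ A B R, Mv A B ∧ L = A + R ∧ L' = B + R

lemma RC (v : ℕ) (L) (hL : Valid L) :
    S (tR true v) L + S (tR false v) L = S (tD v) L + S (tC v v) L := by
  induction L using Multiset.induction with
  | empty => simp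
  | cons a s ih =>
    have := ih (fun i j h => hL i j (by simp [h]))
    simp only [S_cons]
    have : tR true v a + tR false v a = tD v a + tC v v a := by
      cases a with
      | sgn s i => cases s <;> simp [tR, tD, tC]
      | pair i j =>
        have := hL i j (by simp)
        simp only [tR, tD, tC]; split_ifs <;> omega
    omega

lemma split2 {L : Multiset Ty} {x y : Ty} (hx : x ∈ L) (hy : y ∈ L) (h : y ≠ x) :
    ∃ R, L = {x, y} + R := by
  obtain ⟨R, rfl⟩ := Multiset.exists_cons_of_mem hx
  have : y ∈ R := by simpa [h] using hy
  obtain ⟨R', rfl⟩ := Multiset.exists_cons_of_mem this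
  exact ⟨R', by simp [← Multiset.singleton_add, add_assoc]⟩

lemma split3 {L : Multiset Ty} {x y z : Ty} (hx : x ∈ L) (hy : y ∈ L) (hz : z ∈ L) (h : y ≠ x)
    (h' : z ≠ x) (h'' : z ≠ y) :
    ∃ R, L = {x, y, z} + R := by
  obtain ⟨R, rfl⟩ := split2 hx hy h
  have : z ∈ R := by simpa [h', h''] using hz
  obtain ⟨R', rfl⟩ := Multiset.exists_cons_of_mem this
  exact ⟨R', by simp [← Multiset.singleton_add, add_assoc, add_comm, add_left_comm]⟩

lemma split1 {L : Multiset Ty} {x : Ty} (hx : x ∈ L) :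
    ∃ R, L = {x} + R := by
  obtain ⟨R, rfl⟩ := Multiset.exists_cons_of_mem hx
  exact ⟨R, by simp⟩

def Goal (L L' : Multiset Ty) : Prop :=
  ∃ A B R, Mv A B ∧ L' = A + R ∧ Le L (B + R)

lemma use1 {L L' : Multiset Ty} (hle : Le L L') (s : Bool) (i l : ℕ) (hil : i < l)
    (hm : pair i l ∈ L')
    (hR : ∀ v, i ≤ v → v < l → S (tR (!s) v) L + 1 ≤ S (tR (!s) v) L')
    (hC : ∀ v w, i ≤ v → v ≤ w → w < l → S (tC v w) L + 1 ≤ S (tC v w) L') : Goal L L' := by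
  obtain ⟨R, rfl⟩ := split1 hm
  refine ⟨_, _, R, Mv.m1 s i l hil, rfl, ?_, ?_, ?_⟩
  · intro v
    have := hle.D v
    simp only [S_add, S_single, S_insert, Multiset.insert_eq_cons, S_cons, tD] at this ⊢
    omega
  · intro s' v
    have h1 := hle.R s' v
    have h2 := hR v
    simp only [S_add, S_single, S_insert, Multiset.insert_eq_cons, S_cons, tR] at h1 h2 ⊢
    cases s <;> cases s' <;> simp at * <;> split_ifs at * <;> omega
  · intro v w hvw
    have h1 := hle.C v w hvw
    have h2 := hC v w
    simp only [S_add, S_single, S_insert, Multiset.insert_eq_cons, S_cons, tC] at h1 h2 ⊢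
    split_ifs at * <;> omega

lemma use2 {L L' : Multiset Ty} (hle : Le L L') (s : Bool) (i k l : ℕ) (hik : i < k) (hkl : k < l)
    (hm : pair i l ∈ L') (hm' : sgn s k ∈ L')
    (hR : ∀ v, k ≤ v → v < l → S (tR s v) L + 1 ≤ S (tR s v) L')
    (hC : ∀ v w, i ≤ v → v ≤ w → k ≤ w → w < l → S (tC v w) L + 1 ≤ S (tC v w) L') :
    Goal L L' := by
  obtain ⟨R, rfl⟩ := split2 hm hm' (by simp)
  refine ⟨_, _, R, Mv.m2 s i k l hik hkl, rfl, ?_, ?_, ?_⟩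
  · intro v
    have := hle.D v
    simp only [S_add, S_single, S_insert, Multiset.insert_eq_cons, S_cons, tD] at this ⊢
    omega
  · intro s' v
    have h1 := hle.R s' v
    have h2 := hR v
    simp only [S_add, S_single, S_insert, Multiset.insert_eq_cons, S_cons, tR] at h1 h2 ⊢
    cases s <;> cases s' <;> simp at * <;> split_ifs at * <;> omega
  · intro v w hvw
    have h1 := hle.C v w hvw
    have h2 := hC v w
    simp only [S_add, S_single, S_insert, Multiset.insert_eq_cons, S_cons, tC] at h1 h2 ⊢
    split_ifs at * <;> omega

lemma use2' {L L' : Multiset Ty} (hle : Le L L') (s : Bool) (i k l : ℕ) (hik : i < k) (hkl : k < l)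
    (hm : pair i l ∈ L') (hm' : sgn s k ∈ L')
    (hR : ∀ v, i ≤ v → v < k → S (tR (!s) v) L + 1 ≤ S (tR (!s) v) L')
    (hC : ∀ v w, i ≤ v → v ≤ w → v < k → w < l → S (tC v w) L + 1 ≤ S (tC v w) L') :
    Goal L L' := by
  obtain ⟨R, rfl⟩ := split2 hm hm' (by simp)
  refine ⟨_, _, R, Mv.m2' s i k l hik hkl, rfl, ?_, ?_, ?_⟩
  · intro v
    have := hle.D v
    simp only [S_add, S_single, S_insert, Multiset.insert_eq_cons, S_cons, tD] at this ⊢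
    omega
  · intro s' v
    have h1 := hle.R s' v
    have h2 := hR v
    simp only [S_add, S_single, S_insert, Multiset.insert_eq_cons, S_cons, tR] at h1 h2 ⊢
    cases s <;> cases s' <;> simp at * <;> split_ifs at * <;> omega
  · intro v w hvw
    have h1 := hle.C v w hvw
    have h2 := hC v w
    simp only [S_add, S_single, S_insert, Multiset.insert_eq_cons, S_cons, tC] at h1 h2 ⊢
    split_ifs at * <;> omega

lemma use3 {L L' : Multiset Ty} (hle : Le L L') (i h j l : ℕ) (h1 : i < h) (h2 : h < j) (h3 : j < l)
    (hm : pair i l ∈ L') (hm' : pair h j ∈ L')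
    (hC : ∀ v w, i ≤ v → v < h → j ≤ w → w < l → S (tC v w) L + 1 ≤ S (tC v w) L') :
    Goal L L' := by
  obtain ⟨R, rfl⟩ := split2 hm hm' (by simp; omega)
  refine ⟨_, _, R, Mv.m3 i h j l h1 h2 h3, rfl, ?_, ?_, ?_⟩
  · intro v
    have := hle.D v
    simp only [S_add, S_single, S_insert, Multiset.insert_eq_cons, S_cons, tD] at this ⊢
    omega
  · intro s' v
    have h1 := hle.R s' v
    simp only [S_add, S_single, S_insert, Multiset.insert_eq_cons, S_cons, tR] at h1 ⊢
    omega
  · intro v w hvw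
    have h1 := hle.C v w hvw
    have h2 := hC v w
    simp only [S_add, S_single, S_insert, Multiset.insert_eq_cons, S_cons, tC] at h1 h2 ⊢
    split_ifs at * <;> omega

lemma use4 {L L' : Multiset Ty} (hle : Le L L') (s : Bool) (i t k l : ℕ)
    (h1 : i < t) (h2 : t ≤ k) (h3 : k < l)
    (hm : pair i l ∈ L') (hm' : sgn s t ∈ L') (hm'' : sgn (!s) k ∈ L')
    (hR : ∀ v, t ≤ v → v < k → S (tR s v) L + 1 ≤ S (tR s v) L')
    (hC : ∀ v w, i ≤ v → v ≤ w → v < k → t ≤ w → w < l → S (tC v w) L + 1 ≤ S (tC v w) L') :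
    Goal L L' := by
  obtain ⟨R, rfl⟩ := split3 hm hm' hm'' (by simp) (by simp) (by simp)
  refine ⟨_, _, R, Mv.m4 s i t k l h1 h2 h3, rfl, ?_, ?_, ?_⟩
  · intro v
    have := hle.D v
    simp only [S_add, S_single, S_insert, Multiset.insert_eq_cons, S_cons, tD] at this ⊢
    omega
  · intro s' v
    have h1 := hle.R s' v
    have h2 := hR v
    simp only [S_add, S_single, S_insert, Multiset.insert_eq_cons, S_cons, tR] at h1 h2 ⊢
    cases s <;> cases s' <;> simp at * <;> split_ifs at * <;> omega
  · intro v w hvw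
    have h1 := hle.C v w hvw
    have h2 := hC v w
    simp only [S_add, S_single, S_insert, Multiset.insert_eq_cons, S_cons, tC] at h1 h2 ⊢
    split_ifs at * <;> omega

lemma use5 {L L' : Multiset Ty} (hle : Le L L') (i h l r : ℕ)
    (h1 : i < h) (h2 : h < l) (h3 : l < r)
    (hm : pair i l ∈ L') (hm' : pair h r ∈ L')
    (hR : ∀ s v, h ≤ v → v < l → S (tR s v) L + 1 ≤ S (tR s v) L')
    (hC : ∀ v w, i ≤ v → v < h → h ≤ w → w < l → S (tC v w) L + 1 ≤ S (tC v w) L')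
    (hC2 : ∀ v w, h ≤ v → v ≤ w → w < l → S (tC v w) L + 2 ≤ S (tC v w) L')
    (hC3 : ∀ v w, h ≤ v → v < l → l ≤ w → w < r → S (tC v w) L + 1 ≤ S (tC v w) L') :
    Goal L L' := by
  obtain ⟨R, rfl⟩ := split2 hm hm' (by simp; omega)
  refine ⟨_, _, R, Mv.m5 i h l r h1 h2 h3, rfl, ?_, ?_, ?_⟩
  · intro v
    have := hle.D v
    simp only [S_add, S_single, S_insert, Multiset.insert_eq_cons, S_cons, tD] at this ⊢
    omega
  · intro s' v
    have h1 := hle.R s' v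
    have h2 := hR s' v
    simp only [S_add, S_single, S_insert, Multiset.insert_eq_cons, S_cons, tR] at h1 h2 ⊢
    split_ifs at * <;> omega
  · intro v w hvw
    have h1 := hle.C v w hvw
    have h2 := hC v w
    have h3 := hC2 v w
    have h4 := hC3 v w
    simp only [S_add, S_single, S_insert, Multiset.insert_eq_cons, S_cons, tC] at h1 h2 h3 h4 ⊢
    split_ifs at * <;> omega

end Cl

namespace Cl
open Ty

lemma comb0 {L L' : Multiset Ty} (Φ : Ty → ℤ) (h' : ∀ x ∈ L', 0 ≤ Φ x) (h : ∀ x ∈ L, Φ x ≤ 0) :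
    S Φ L ≤ S Φ L' := by
  have := S_nonneg Φ L' h'
  have := S_nonpos Φ L h
  omega

lemma comb1 {L L' : Multiset Ty} (Φ : Ty → ℤ) (h' : ∀ x ∈ L', 0 ≤ Φ x) (h : ∀ x ∈ L, Φ x ≤ 0)
    (x0) (hx : x0 ∈ L) (h0 : Φ x0 ≤ -1) :
    S Φ L + 1 ≤ S Φ L' := by
  have := S_nonneg Φ L' h'
  have := S_nonpos' Φ L h x0 hx h0
  omega

lemma first (P : ℕ → Prop) (a l : ℕ) (h : a ≤ l) :
    ∃ K, a ≤ K ∧ K ≤ l ∧ (∀ k, a ≤ k → k < K → ¬ P k) ∧ (K < l → P K) := by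
  classical
  by_cases hex : ∃ k, a ≤ k ∧ k < l ∧ P k
  · refine ⟨Nat.find hex, (Nat.find_spec hex).1, (Nat.find_spec hex).2.1.le, ?_,
      fun _ => (Nat.find_spec hex).2.2⟩
    intro k hak hk hP
    have := Nat.find_min hex hk
    have h2 := (Nat.find_spec hex).2.1
    exact this ⟨hak, by omega, hP⟩
  · push Not at hex
    exact ⟨l, h, le_rfl, hex, fun h => absurd h (lt_irrefl _)⟩

def pos : Ty → ℕ
  | sgn _ i => i
  | pair i _ => i

lemma minimal (P : ℕ → Prop) (h : ∃ n, P n) : ∃ n, P n ∧ ∀ m, P m → n ≤ m := by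
  classical
  exact ⟨Nat.find h, Nat.find_spec h, fun m hm => Nat.find_min' h hm⟩

lemma case1 {L L' : Multiset Ty} (hL : Valid L) (hL' : Valid L') (hle : Le L L')
    (hdis : ∀ x ∈ L, x ∉ L') (i : ℕ) (hi : ∀ x ∈ L, i ≤ pos x) (hi' : ∀ x ∈ L', i ≤ pos x)
    (s : Bool) (hs : sgn s i ∈ L) : Goal L L' := by
  have hs' := hdis _ hs
  have hex : ∃ l, pair i l ∈ L' := by
    have h1 : 1 ≤ S (tR s i) L := S_pos _ _ (fun x _ => by
      cases x <;> simp only [tR] <;> split_ifs <;> omega) _ hs (by simp [tR])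
    have h2 := hle.R s i
    obtain ⟨x, hx, hx0⟩ := exists_of_S_pos (tR s i) L' (by omega)
    have hp := hi' x hx
    cases x with
    | sgn s' j =>
      simp only [tR, pos] at hx0 hp
      split_ifs at hx0 with hc
      · obtain ⟨rfl, hc⟩ := hc
        have : j = i := by omega
        subst this; exact absurd hx hs'
      · omega
    | pair h j =>
      simp only [tR, pos] at hx0 hp
      split_ifs at hx0 with hc
      · have : h = i := by omega
        subst this; exact ⟨j, hx⟩
      · omega
  obtain ⟨l, hl, hmin⟩ := minimal _ hex
  have hil := hL' _ _ hl
  obtain ⟨K, hK1, hK2, hK3, hK4⟩ := first (fun k => sgn s k ∈ L' ∨ ∃ j < l, pair k j ∈ L') (i+1) l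
    (by omega)
  have key : ∀ x ∈ L', ∀ v, i ≤ v → v < K →
      (∀ s' j, x = sgn s' j → j ≤ v → s' = !s) ∧
      (∀ h j, x = pair h j → h ≤ v → l ≤ j) := by
    intro x hx v hv hvK
    constructor
    · rintro s' j rfl hj
      have hp := hi' _ hx
      simp only [pos] at hp
      by_contra hne
      have : s' = s := by cases s <;> cases s' <;> simp_all
      subst this
      rcases Nat.eq_or_lt_of_le hp with rfl | hp
      · exact hs' hx
      · exact hK3 j (by omega) (by omega) (Or.inl hx)
    · rintro h j rfl hj
      have hp := hi' _ hx
      simp only [pos] at hp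
      rcases Nat.eq_or_lt_of_le hp with rfl | hp
      · exact hmin _ hx
      · by_contra hc
        exact hK3 h (by omega) (by omega) (Or.inr ⟨j, by omega, hx⟩)
  have cR : ∀ v, i ≤ v → v < K → S (tR (!s) v) L + 1 ≤ S (tR (!s) v) L' := by
    intro v hv hvK
    have := comb1 (L := L) (L' := L') (fun x => tR (!s) v x - tD v x) (by
      intro x hx
      obtain ⟨k1, k2⟩ := key x hx v hv hvK
      cases x with
      | sgn s' j =>
        have := k1 s' j rfl
        simp only [tR, tD]
        split_ifs with h1 h2 <;> simp_all
      | pair h j =>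
        have := k2 h j rfl
        have := hL' _ _ hx
        simp only [tR, tD]
        split_ifs <;> omega) (by
      intro x hx
      cases x <;> simp only [tR, tD] <;> split_ifs <;> simp_all) _ hs (by simp [tR, tD, hv])
    rw [S_sub, S_sub, hle.D] at this
    omega
  have cC : ∀ v w, i ≤ v → v ≤ w → v < K → w < l → S (tC v w) L + 1 ≤ S (tC v w) L' := by
    intro v w hv hvw hvK hw
    have := comb0 (L := L) (L' := L') (fun x => tC v w x - tC v v x) (by
      intro x hx
      obtain ⟨k1, k2⟩ := key x hx v hv hvK
      cases x with
      | sgn s' j => simp [tC]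
      | pair h j =>
        have := k2 h j rfl
        simp only [tC]
        split_ifs <;> omega) (by
      intro x hx
      cases x <;> simp only [tC] <;> (try split_ifs) <;> omega)
    rw [S_sub, S_sub] at this
    have h1 := RC v L hL
    have h2 := RC v L' hL'
    have h3 := cR v hv hvK
    have h4 := hle.R s v
    have h5 := hle.D v
    cases s <;> simp at h3 h4 <;> omega
  by_cases hKl : K < l
  · rcases hK4 hKl with h | ⟨j, hj, h⟩
    · exact use2' hle s i K l (by omega) hKl hl h cR (fun v w h1 h2 h3 h4 => cC v w h1 h2 h3 h4)
    · have := hL' _ _ h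
      exact use3 hle i K j l (by omega) (by omega) hj hl h
        (fun v w h1 h2 h3 h4 => cC v w h1 (by omega) h2 h4)
  · have : K = l := by omega
    subst this
    exact use1 hle s i K hil hl cR (fun v w h1 h2 h3 => cC v w h1 h2 (by omega) h3)

lemma pt1 (s : Bool) (u v : ℕ) (h : u ≤ v) (x : Ty) :
    (tR s v x - tR s u x) - (tD v x - tD u x) ≤ 0 := by
  cases x with
  | sgn s' j =>
    simp only [tR, tD]
    by_cases hss : s' = s
    · simp [hss]
    · simp only [hss, false_and, if_false]; split_ifs <;> omega
  | pair h j => simp only [tR, tD]; split_ifs <;> omega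

lemma pt2 (s : Bool) (u v : ℕ) (j : ℕ) :
    (tR s v (sgn s j) - tR s u (sgn s j)) - (tD v (sgn s j) - tD u (sgn s j)) = 0 := by
  simp [tR, tD]

lemma pt3 (s : Bool) (t v : ℕ) (j : ℕ) (hv : t ≤ v) (ht : 0 < t) (h : t ≤ j → v < j) :
    0 ≤ (tR s v (sgn (!s) j) - tR s (t-1) (sgn (!s) j)) - (tD v (sgn (!s) j) - tD (t-1) (sgn (!s) j)) := by
  simp only [tR, tD, Bool.not_eq_self, false_and, if_false]
  split_ifs <;> omega

set_option maxHeartbeats 1000000 in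
lemma case2 {L L' : Multiset Ty} (hL : Valid L) (hL' : Valid L') (hle : Le L L')
    (hdis : ∀ x ∈ L, x ∉ L') (i : ℕ) (hi : ∀ x ∈ L, i ≤ pos x) (hi' : ∀ x ∈ L', i ≤ pos x)
    (t : ℕ) (ht : pair i t ∈ L) : Goal L L' := by
  have ht' := hdis _ ht
  have hit := hL _ _ ht
  have hex : ∃ l, t < l ∧ pair i l ∈ L' := by
    have h1 : 1 ≤ S (tC i (t-1)) L := S_pos _ _ (fun x _ => by
      cases x <;> simp only [tC] <;> (try split_ifs) <;> omega) _ ht (by simp [tC]; omega)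
    have h2 := hle.C i (t-1) (by omega)
    obtain ⟨x, hx, hx0⟩ := exists_of_S_pos (tC i (t-1)) L' (by omega)
    have hp := hi' x hx
    cases x with
    | sgn s' j => simp [tC] at hx0
    | pair h j =>
      simp only [tC, pos] at hx0 hp
      split_ifs at hx0 with hc
      · have : h = i := by omega
        subst this
        have : j ≠ t := by rintro rfl; exact ht' hx
        exact ⟨j, by omega, hx⟩
      · omega
  obtain ⟨l, ⟨htl, hl⟩, hmin⟩ := minimal _ hex
  have hil := hL' _ _ hl
  have cA : ∀ v, i ≤ v → v < t → (∀ h j, pair h j ∈ L' → h ≤ v → t ≤ j → l ≤ j) →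
      ∀ w, t ≤ w → w < l → S (tC v w) L + 1 ≤ S (tC v w) L' := by
    intro v hv hvt hno w hw hwl
    have := comb1 (L := L) (L' := L') (fun x => tC v w x - tC v (t-1) x) (by
      intro x hx
      cases x with
      | sgn s' j => simp [tC]
      | pair h j =>
        have := hno h j hx
        simp only [tC]
        split_ifs <;> omega) (by
      intro x hx
      cases x <;> simp only [tC] <;> (try split_ifs) <;> omega) _ ht (by
        simp only [tC]
        split_ifs <;> omega)
    rw [S_sub, S_sub] at this
    have := hle.C v (t-1) (by omega)
    omega
  have hrow : ∀ j, pair i j ∈ L' → t ≤ j → l ≤ j := by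
    intro j hj htj
    refine hmin _ ⟨?_, hj⟩
    rcases Nat.eq_or_lt_of_le htj with rfl | h
    · exact absurd hj ht'
    · exact h
  by_cases h2a : ∃ h, i < h ∧ h < t ∧ ∃ j, t ≤ j ∧ j < l ∧ pair h j ∈ L'
  · obtain ⟨h, ⟨h1, h2, j, h3, h4, h5⟩, hm⟩ := minimal _ h2a
    refine use3 hle i h j l h1 (by omega) h4 hl h5 ?_
    intro v w hv hvh hw hwl
    refine cA v hv (by omega) ?_ w (by omega) hwl
    intro h' j' hp hh' hj'
    have hp' := hi' _ hp
    simp only [pos] at hp'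
    rcases Nat.eq_or_lt_of_le hp' with rfl | hp'
    · exact hrow _ hp hj'
    · by_contra hc
      have := hm h' ⟨hp', by omega, j', hj', by omega, hp⟩
      omega
  have hno : ∀ h j, pair h j ∈ L' → h < t → t ≤ j → l ≤ j := by
    intro h j hp hh hj
    have hp' := hi' _ hp
    simp only [pos] at hp'
    rcases Nat.eq_or_lt_of_le hp' with rfl | hp'
    · exact hrow _ hp hj
    · by_contra hc
      exact h2a ⟨h, hp', hh, j, hj, by omega, hp⟩
  clear h2a
  replace cA : ∀ v w, i ≤ v → v < t → t ≤ w → w < l → S (tC v w) L + 1 ≤ S (tC v w) L' :=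
    fun v w h1 h2 h3 h4 => cA v h1 h2 (fun h j hp hh hj => hno h j hp (by omega) hj) w h3 h4
  have cR : ∀ s v, t ≤ v → (∀ j, sgn (!s) j ∈ L' → t ≤ j → v < j) →
      (∀ h j, pair h j ∈ L' → t ≤ h → h ≤ v → v < j) → v < l →
      S (tR s v) L + 1 ≤ S (tR s v) L' := by
    intro s v hv hsg hpr hvl
    have := comb1 (L := L) (L' := L')
      (fun x => (tR s v x - tR s (t-1) x) - (tD v x - tD (t-1) x)) (by
      intro x hx
      cases x with
      | sgn s' j =>
        by_cases hss : s' = s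
        · subst hss
          exact (pt2 _ _ _ _).ge
        · have : s' = !s := by cases s <;> cases s' <;> simp_all
          subst this
          exact pt3 s t v j hv (by omega) (hsg j hx)
      | pair h j =>
        have := hpr h j hx
        have := hno h j hx
        have := hL' _ _ hx
        simp only [tR, tD]
        split_ifs <;> omega) (by
      intro x hx
      exact pt1 s _ _ (by omega) x) _ ht (by
        simp only [tR, tD]
        split_ifs <;> omega)
    simp only [S_sub] at this
    have := hle.R s (t-1)
    have := hle.D v
    have := hle.D (t-1)
    omega
  by_cases h2b : ∃ s, sgn s t ∈ L'
  · obtain ⟨s, hs⟩ := h2b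
    by_cases hs' : sgn (!s) t ∈ L'
    · exact use4 hle s i t t l hit le_rfl htl hl hs hs' (fun v h1 h2 => by omega)
        (fun v w h1 h2 h3 h4 h5 => cA v w h1 h3 h4 h5)
    obtain ⟨K, hK1, hK2, hK3, hK4⟩ :=
      first (fun k => sgn (!s) k ∈ L' ∨ ∃ j < l, pair k j ∈ L') t l (by omega)
    have hfar : ∀ h j, pair h j ∈ L' → t ≤ h → h < K → l ≤ j := by
      intro h j hp h1 h2
      by_contra hc
      exact hK3 h h1 h2 (Or.inr ⟨j, by omega, hp⟩)
    have cR' : ∀ v, t ≤ v → v < K → S (tR s v) L + 1 ≤ S (tR s v) L' := by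
      intro v hv hvK
      refine cR s v hv ?_ ?_ (by omega)
      · intro j hj htj
        by_contra hc
        exact hK3 j htj (by omega) (Or.inl hj)
      · intro h j hp h1 h2
        have := hfar h j hp h1 (by omega)
        omega
    have cC : ∀ v w, t ≤ v → v ≤ w → v < K → w < l → S (tC v w) L + 1 ≤ S (tC v w) L' := by
      intro v w hv hvw hvK hw
      have := comb0 (L := L) (L' := L') (fun x => tC v w x - tC v v x) (by
        intro x hx
        cases x with
        | sgn s' j => simp [tC]
        | pair h j =>
          have := hfar h j hx
          have := hno h j hx
          simp only [tC]
          split_ifs <;> omega) (by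
        intro x hx
        cases x <;> simp only [tC] <;> (try split_ifs) <;> omega)
      rw [S_sub, S_sub] at this
      have h1 := RC v L hL
      have h2 := RC v L' hL'
      have h3 := cR' v hv hvK
      have h4 := hle.R (!s) v
      have h5 := hle.D v
      cases s <;> simp at h3 h4 <;> omega
    have cC' : ∀ v w, i ≤ v → v ≤ w → v < K → t ≤ w → w < l → S (tC v w) L + 1 ≤ S (tC v w) L' := by
      intro v w h1 h2 h3 h4 h5
      by_cases hvt : v < t
      · exact cA v w h1 hvt h4 h5
      · exact cC v w (by omega) h2 h3 h5
    by_cases hKl : K < l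
    · rcases hK4 hKl with h | ⟨j, hj, h⟩
      · exact use4 hle s i t K l hit hK1 hKl hl hs h cR' cC'
      · have := hL' _ _ h
        exact use3 hle i K j l (by omega) (by omega) hj hl h
          (fun v w h1 h2 h3 h4 => cC' v w h1 (by omega) h2 (by omega) h4)
    · have : K = l := by omega
      subst this
      exact use2 hle s i t K hit htl hl hs cR' (fun v w h1 h2 h3 h4 => cC' v w h1 h2 (by omega) h3 h4)
  · push Not at h2b
    obtain ⟨K, hK1, hK2, hK3, hK4⟩ :=
      first (fun k => (∃ s, sgn s k ∈ L') ∨ ∃ j < l, pair k j ∈ L') t l (by omega)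
    have hfar : ∀ h j, pair h j ∈ L' → t ≤ h → h < K → l ≤ j := by
      intro h j hp h1 h2
      by_contra hc
      exact hK3 h h1 h2 (Or.inr ⟨j, by omega, hp⟩)
    have hsg : ∀ s j, sgn s j ∈ L' → t ≤ j → K ≤ j := by
      intro s j hp h1
      by_contra hc
      exact hK3 j h1 (by omega) (Or.inl ⟨s, hp⟩)
    have cR' : ∀ s v, t ≤ v → v < K → S (tR s v) L + 1 ≤ S (tR s v) L' := by
      intro s v hv hvK
      refine cR s v hv ?_ ?_ (by omega)
      · intro j hj htj
        have := hsg _ j hj htj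
        omega
      · intro h j hp h1 h2
        have := hfar h j hp h1 (by omega)
        omega
    have hext : ∃ j, pair t j ∈ L' := by
      have h1 : 1 ≤ S (fun x => tD t x - tD (t-1) x) L := S_pos _ _ (fun x _ => by
        cases x <;> simp only [tD] <;> split_ifs <;> omega) _ ht (by
          simp only [tD]; split_ifs <;> omega)
      have h2 : 0 < S (fun x => tD t x - tD (t-1) x) L' := by
        rw [S_sub] at h1 ⊢
        have := hle.D t
        have := hle.D (t-1)
        omega
      obtain ⟨x, hx, hx0⟩ := exists_of_S_pos _ L' h2
      cases x with
      | sgn s j =>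
        simp only [tD] at hx0
        have : j = t := by split_ifs at hx0 <;> omega
        subst this
        exact absurd hx (h2b s)
      | pair h j =>
        simp only [tD] at hx0
        have h3 := hno h j hx
        have h4 := hL' _ _ hx
        have : h = t := by split_ifs at hx0 <;> omega
        subst this
        exact ⟨j, hx⟩
    by_cases hKt : K = t
    · subst hKt
      rcases hK4 htl with ⟨s, hs⟩ | ⟨j, hj, hp⟩
      · exact absurd hs (h2b s)
      · have := hL' _ _ hp
        exact use3 hle i K j l hit this hj hl hp
          (fun v w h1 h2 h3 h4 => cA v w h1 h2 (by omega) h4)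
    obtain ⟨jt, hjt⟩ := hext
    obtain ⟨r, ⟨h, hth, hhK, hhr⟩, hrmin⟩ := minimal (fun r => ∃ h, t ≤ h ∧ h < K ∧ pair h r ∈ L')
      ⟨jt, t, le_rfl, by omega, hjt⟩
    have hlr : l ≤ r := hfar h r hhr hth hhK
    have cC : ∀ v w, t ≤ v → v ≤ w → v < K → w < r →
        S (tC v w) L + 1 + (S (tC (t-1) w) L' - S (tC (t-1) w) L) ≤ S (tC v w) L' := by
      intro v w hv hvw hvK hw
      have := comb1 (L := L) (L' := L')
        (fun x => (tC v w x - tC (t-1) w x) - (tD v x - tD (t-1) x)) (by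
        intro x hx
        cases x with
        | sgn s' j =>
          have := hsg s' j hx
          simp only [tC, tD]
          split_ifs <;> omega
        | pair h' j =>
          have h1 := hfar h' j hx
          have h2 := hno h' j hx
          have h3 := hL' _ _ hx
          have h4 : t ≤ h' → h' < K → r ≤ j := fun h1 h2 => hrmin j ⟨h', h1, h2, hx⟩
          simp only [tC, tD]
          split_ifs <;> omega) (by
        intro x hx
        cases x <;> simp only [tC, tD] <;> split_ifs <;> omega) _ ht (by
          simp only [tC, tD]
          split_ifs <;> omega)
      simp only [S_sub] at this
      have := hle.D v
      have := hle.D (t-1)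
      omega
    have cC1 : ∀ v w, t ≤ v → v ≤ w → v < K → w < r → S (tC v w) L + 1 ≤ S (tC v w) L' := by
      intro v w h1 h2 h3 h4
      have := cC v w h1 h2 h3 h4
      have := hle.C (t-1) w (by omega)
      omega
    have cC2 : ∀ v w, t ≤ v → v ≤ w → v < K → w < l → S (tC v w) L + 2 ≤ S (tC v w) L' := by
      intro v w h1 h2 h3 h4
      have := cC v w h1 h2 h3 (by omega)
      have := cA (t-1) w (by omega) (by omega) (by omega) h4
      omega
    have cC' : ∀ v w, i ≤ v → v ≤ w → v < K → t ≤ w → w < l → S (tC v w) L + 1 ≤ S (tC v w) L' := by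
      intro v w h1 h2 h3 h4 h5
      by_cases hvt : v < t
      · exact cA v w h1 hvt h4 h5
      · exact cC1 v w (by omega) h2 h3 (by omega)
    by_cases hKl : K < l
    · rcases hK4 hKl with ⟨s, hs⟩ | ⟨j, hj, hp⟩
      · exact use2' hle s h K r hhK (by omega) hhr hs (fun v h1 h2 => cR' _ v (by omega) h2)
          (fun v w h1 h2 h3 h4 => cC1 v w (by omega) h2 h3 h4)
      · have := hL' _ _ hp
        exact use3 hle i K j l (by omega) (by omega) hj hl hp
          (fun v w h1 h2 h3 h4 => cC' v w h1 (by omega) h2 (by omega) h4)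
    · have : K = l := by omega
      subst this
      rcases Nat.eq_or_lt_of_le hlr with rfl | hlr
      · exact use1 hle true h K hhK hhr (fun v h1 h2 => cR' _ v (by omega) h2)
          (fun v w h1 h2 h3 => cC1 v w (by omega) h2 (by omega) h3)
      · exact use5 hle i h K r (by omega) hhK hlr hl hhr
          (fun s v h1 h2 => cR' s v (by omega) h2)
          (fun v w h1 h2 h3 h4 => cC' v w h1 (by omega) (by omega) (by omega) h4)
          (fun v w h1 h2 h3 => cC2 v w (by omega) h2 (by omega) h3)
          (fun v w h1 h2 h3 h4 => cC1 v w (by omega) (by omega) h2 h4)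

lemma goal_of_disjoint {L L' : Multiset Ty} (hL : Valid L) (hL' : Valid L') (hle : Le L L')
    (hdis : ∀ x ∈ L, x ∉ L') (hne : L ≠ L') : Goal L L' := by
  have hex : ∃ n, ∃ x, (x ∈ L ∨ x ∈ L') ∧ pos x = n := by
    by_contra hc
    push Not at hc
    apply hne
    rw [Multiset.eq_zero_of_forall_notMem (fun x hx => hc _ x (Or.inl hx) rfl),
      Multiset.eq_zero_of_forall_notMem (fun x hx => hc _ x (Or.inr hx) rfl)]
  obtain ⟨i, ⟨x, hx, hxi⟩, hmin⟩ := minimal _ hex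
  have hi : ∀ x ∈ L, i ≤ pos x := fun x hx => hmin _ ⟨x, Or.inl hx, rfl⟩
  have hi' : ∀ x ∈ L', i ≤ pos x := fun x hx => hmin _ ⟨x, Or.inr hx, rfl⟩
  have h0 : ∀ x, 0 ≤ tD i x := fun x => by cases x <;> simp only [tD] <;> split_ifs <;> omega
  have h1 : 1 ≤ tD i x := by
    subst hxi
    cases x <;> simp only [tD, pos] <;> split_ifs <;> omega
  have h2 : 1 ≤ S (tD i) L := by
    rcases hx with hx | hx
    · exact S_pos _ _ (fun x _ => h0 x) x hx h1
    · rw [hle.D]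
      exact S_pos _ _ (fun x _ => h0 x) x hx h1
  obtain ⟨y, hy, hy0⟩ := exists_of_S_pos _ L (by omega : 0 < S (tD i) L)
  have hp := hi y hy
  cases y with
  | sgn s j =>
    simp only [tD, pos] at hy0 hp
    have : j = i := by split_ifs at hy0 <;> omega
    subst this
    exact case1 hL hL' hle hdis j hi hi' s hy
  | pair h j =>
    simp only [tD, pos] at hy0 hp
    have := hL _ _ hy
    have : h = i := by split_ifs at hy0 <;> omega
    subst this
    exact case2 hL hL' hle hdis h hi hi' j hy

def wt (L : Multiset Ty) : ℕ := (L.map (fun x => match x with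
  | sgn _ _ => 0
  | pair i j => (j - i)^2)).sum

@[simp] lemma wt_add (L M) : wt (L + M) = wt L + wt M := by simp [wt]

lemma wt_mv {A B} (h : Mv A B) : wt B < wt A := by
  cases h with
  | m1 s i l h =>
    have : 0 < l - i := by omega
    have : 0 < (l - i)^2 := by positivity
    simpa [wt] using this
  | m2 s i k l h h' =>
    simp [wt]
    exact Nat.pow_lt_pow_left (by omega) (by norm_num)
  | m2' s i k l h h' =>
    simp [wt]
    exact Nat.pow_lt_pow_left (by omega) (by norm_num)
  | m3 i h j l h1 h2 h3 =>
    simp [wt]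
    obtain ⟨a, rfl⟩ := Nat.exists_eq_add_of_lt h1
    obtain ⟨b, rfl⟩ := Nat.exists_eq_add_of_lt h2
    obtain ⟨c, rfl⟩ := Nat.exists_eq_add_of_lt h3
    have e1 : i + a + 1 + b + 1 + c + 1 - i = a + b + c + 3 := by omega
    have e2 : i + a + 1 + b + 1 - (i + a + 1) = b + 1 := by omega
    have e3 : i + a + 1 + b + 1 - i = a + b + 2 := by omega
    have e4 : i + a + 1 + b + 1 + c + 1 - (i + a + 1) = b + c + 2 := by omega
    rw [e1, e2, e3, e4]; nlinarith [Nat.zero_le (a*b), Nat.zero_le (a*c), Nat.zero_le (b*c)]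
  | m4 s i t k l h1 h2 h3 =>
    simp [wt]
    obtain ⟨a, rfl⟩ := Nat.exists_eq_add_of_lt h1
    obtain ⟨b, rfl⟩ := Nat.exists_eq_add_of_le h2
    obtain ⟨c, rfl⟩ := Nat.exists_eq_add_of_lt h3
    have e1 : i + a + 1 + b + c + 1 - i = a + b + c + 2 := by omega
    have e3 : i + a + 1 - i = a + 1 := by omega
    have e4 : i + a + 1 + b + c + 1 - (i + a + 1 + b) = c + 1 := by omega
    rw [e1, e3, e4]; nlinarith [Nat.zero_le (a*b), Nat.zero_le (a*c), Nat.zero_le (b*c)]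
  | m5 i h l r h1 h2 h3 =>
    simp [wt]
    obtain ⟨a, rfl⟩ := Nat.exists_eq_add_of_lt h1
    obtain ⟨b, rfl⟩ := Nat.exists_eq_add_of_lt h2
    obtain ⟨c, rfl⟩ := Nat.exists_eq_add_of_lt h3
    have e1 : i + a + 1 + b + 1 - i = a + b + 2 := by omega
    have e2 : i + a + 1 + b + 1 + c + 1 - (i + a + 1) = b + c + 2 := by omega
    have e3 : i + a + 1 - i = a + 1 := by omega
    have e4 : i + a + 1 + b + 1 + c + 1 - (i + a + 1 + b + 1) = c + 1 := by omega
    rw [e1, e2, e3, e4]; nlinarith [Nat.zero_le (a*b), Nat.zero_le (a*c), Nat.zero_le (b*c)]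

lemma valid_mv {A B} (h : Mv A B) : Valid B := by
  cases h <;> intro i j hp <;> simp at hp <;> omega

lemma Le.cancel {L L' R : Multiset Ty} (h : Le (L + R) (L' + R)) : Le L L' := by
  refine ⟨fun v => ?_, fun s v => ?_, fun v w hvw => ?_⟩
  · have := h.D v; simp at this; exact this
  · have := h.R s v; simp at this; exact this
  · have := h.C v w hvw; simp at this; exact this

lemma Le.addR {L L' : Multiset Ty} (h : Le L L') (R) : Le (L + R) (L' + R) := by
  refine ⟨fun v => ?_, fun s v => ?_, fun v w hvw => ?_⟩
  · have := h.D v; simp; exact this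
  · have := h.R s v; simp; exact this
  · have := h.C v w hvw; simp; exact this

/-- Main combinatorial theorem. -/
theorem reach (n : ℕ) : ∀ L L' : Multiset Ty, Valid L → Valid L' → Le L L' → wt L' ≤ n →
    Relation.ReflTransGen Step L' L ∧ (L = L' ∨ wt L < wt L') := by
  induction n using Nat.strong_induction_on with
  | _ n ih =>
  intro L L' hL hL' hle hn
  by_cases heq : L = L'
  · subst heq; exact ⟨.refl, Or.inl rfl⟩
  set R := L ∩ L' with hR
  obtain ⟨L0, h0⟩ := Multiset.le_iff_exists_add.1 (Multiset.inter_le_left : L ∩ L' ≤ L)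
  obtain ⟨L0', h0'⟩ := Multiset.le_iff_exists_add.1 (Multiset.inter_le_right : L ∩ L' ≤ L')
  rw [← hR, add_comm] at h0 h0'
  have hdis : ∀ x ∈ L0, x ∉ L0' := by
    intro x hx hx'
    have h1 : Multiset.count x R = min (Multiset.count x L) (Multiset.count x L') := by
      rw [hR, Multiset.count_inter]
    rw [h0, h0', Multiset.count_add, Multiset.count_add] at h1
    have := Multiset.count_pos.2 hx
    have := Multiset.count_pos.2 hx'
    omega
  clear_value R
  subst h0 h0'
  have hV : Valid L0 := fun i j h => hL i j (by simp [h])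
  have hV' : Valid L0' := fun i j h => hL' i j (by simp [h])
  obtain ⟨A, B, Q, hm, rfl, hle2⟩ := goal_of_disjoint hV hV' hle.cancel hdis
    (fun h => heq (by rw [h]))
  have hw := wt_mv hm
  have hle3 := hle2.addR R
  have hV'' : Valid (B + Q + R) := by
    intro i j hp
    simp only [Multiset.mem_add] at hp
    rcases hp with (hp | hp) | hp
    · exact valid_mv hm _ _ hp
    · exact hL' i j (by simp [hp])
    · exact hL' i j (by simp [hp])
  have hlt : wt (B + Q + R) < wt (A + Q + R) := by simp; omega
  obtain ⟨r1, r2⟩ := ih (wt (B + Q + R)) (by omega) _ _ hL hV'' hle3 le_rfl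
  refine ⟨.head ⟨A, B, Q + R, hm, by rw [add_assoc], by rw [add_assoc]⟩ r1, Or.inr ?_⟩
  rcases r2 with r2 | r2
  · rw [r2]; exact hlt
  · omega

theorem eq_of_le_le {L L' : Multiset Ty} (hL : Valid L) (hL' : Valid L') (h1 : Le L L')
    (h2 : Le L' L) : L = L' := by
  rcases (reach _ L L' hL hL' h1 le_rfl).2 with h | h
  · exact h
  rcases (reach _ L' L hL' hL h2 le_rfl).2 with h' | h'
  · exact h'.symm
  omega

end Cl

namespace Cl
open Ty

/-- A vector space with an endomorphism and a family of subspaces. -/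
structure Obj (k : Type) [Field k] where
  V : Type
  [ac : AddCommGroup V]
  [md : Module k V]
  E : V →ₗ[k] V
  F : ℕ → Submodule k V

attribute [instance] Obj.ac Obj.md

variable {k : Type} [Field k]

def Iso (X Y : Obj k) : Prop :=
  ∃ φ : X.V ≃ₗ[k] Y.V, (∀ z, φ (X.E z) = Y.E (φ z)) ∧ ∀ v z, z ∈ X.F v ↔ φ z ∈ Y.F v

lemma Iso.refl (X : Obj k) : Iso X X := ⟨LinearEquiv.refl k _, by simp, by simp⟩

lemma Iso.symm {X Y : Obj k} (h : Iso X Y) : Iso Y X := by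
  obtain ⟨φ, h1, h2⟩ := h
  refine ⟨φ.symm, fun z => ?_, fun v z => ?_⟩
  · apply φ.injective; rw [h1]; simp
  · rw [h2]; simp

lemma Iso.trans {X Y Z : Obj k} (h : Iso X Y) (h' : Iso Y Z) : Iso X Z := by
  obtain ⟨φ, h1, h2⟩ := h
  obtain ⟨ψ, h3, h4⟩ := h'
  exact ⟨φ.trans ψ, fun z => by simp [h1, h3], fun v z => by rw [h2, h4]; simp⟩

def sum (X Y : Obj k) : Obj k where
  V := X.V × Y.V
  E := X.E.prodMap Y.E
  F v := (X.F v).prod (Y.F v)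

lemma sum_congr {X Y X' Y' : Obj k} (h : Iso X X') (h' : Iso Y Y') :
    Iso (sum X Y) (sum X' Y') := by
  obtain ⟨φ, h1, h2⟩ := h
  obtain ⟨ψ, h3, h4⟩ := h'
  exact ⟨φ.prodCongr ψ, fun z => Prod.ext (h1 z.1) (h3 z.2),
    fun v z => and_congr (h2 v z.1) (h4 v z.2)⟩

lemma sum_comm (X Y : Obj k) : Iso (sum X Y) (sum Y X) :=
  ⟨LinearEquiv.prodComm k _ _, fun z => rfl, fun v z => and_comm⟩

lemma sum_assoc (X Y Z : Obj k) : Iso (sum (sum X Y) Z) (sum X (sum Y Z)) :=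
  ⟨LinearEquiv.prodAssoc k _ _ _, fun z => rfl, fun v z => and_assoc⟩

def zer (k : Type) [Field k] : Obj k where
  V := PUnit
  E := 0
  F _ := ⊥

lemma zer_sum (X : Obj k) : Iso (sum X (zer k)) X :=
  ⟨LinearEquiv.prodUnique (R := k) (M := X.V) (M₂ := PUnit), fun z => rfl, fun v z =>
    ⟨fun h => h.1, fun h => ⟨h, rfl⟩⟩⟩

lemma sum_zer (X : Obj k) : Iso (sum (zer k) X) X := (sum_comm _ _).trans (zer_sum X)

def es (s : Bool) : k →ₗ[k] k := if s then LinearMap.id else 0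

def oS (k : Type) [Field k] (s : Bool) (i : ℕ) : Obj k where
  V := k
  E := es s
  F v := { carrier := {z | v < i → z = 0}
           add_mem' := by intro a b ha hb h; simp only [Set.mem_ofPred_eq] at ha hb; rw [ha h, hb h]; simp
           zero_mem' := fun _ => rfl
           smul_mem' := by intro c a ha h; simp only [Set.mem_ofPred_eq] at ha; rw [ha h]; simp }

def oP (k : Type) [Field k] (s : Bool) (i j : ℕ) : Obj k where
  V := k × k
  E := (es s).prodMap (es (!s))
  F v := { carrier := {z | (v < i → z.1 = 0 ∧ z.2 = 0) ∧ (v < j → z.1 = z.2)}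
           add_mem' := by
            intro a b ha hb
            refine ⟨fun h => ?_, fun h => ?_⟩
            · simp [ha.1 h, hb.1 h]
            · simp [ha.2 h, hb.2 h]
           zero_mem' := by simp
           smul_mem' := by
            intro c a ha
            refine ⟨fun h => ?_, fun h => ?_⟩
            · simp [ha.1 h]
            · simp [ha.2 h] }

lemma oP_swap (s s' : Bool) (i j : ℕ) : Iso (oP k s i j) (oP k s' i j) := by
  by_cases h : s = s'
  · subst h; exact Iso.refl _
  have : s' = !s := by cases s <;> cases s' <;> simp_all
  subst this
  refine ⟨LinearEquiv.prodComm k k k, fun z => ?_, fun v z => ?_⟩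
  · cases s <;> rfl
  · exact and_congr (imp_congr_right fun _ => and_comm) (imp_congr_right fun _ => eq_comm)

def ob (k : Type) [Field k] : Ty → Obj k
  | sgn s i => oS k s i
  | pair i j => oP k true i j

def mdl (k : Type) [Field k] : List Ty → Obj k
  | [] => zer k
  | x :: l => sum (ob k x) (mdl k l)

lemma mdl_append (l m : List Ty) : Iso (mdl k (l ++ m)) (sum (mdl k l) (mdl k m)) := by
  induction l with
  | nil => exact (sum_zer _).symm
  | cons x l ih =>
    exact (sum_congr (Iso.refl _) ih).trans (sum_assoc _ _ _).symm

lemma mdl_perm {l m : List Ty} (h : l.Perm m) : Iso (mdl k l) (mdl k m) := by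
  induction h with
  | nil => exact Iso.refl _
  | cons x _ ih => exact sum_congr (Iso.refl _) ih
  | swap x y l =>
    exact ((sum_assoc _ _ _).symm.trans (sum_congr (sum_comm _ _) (Iso.refl _))).trans (sum_assoc _ _ _)
  | trans _ _ h1 h2 => exact h1.trans h2

def Deg (X Y : Obj k) : Prop :=
  ∃ H : Y.V →ₗ[k] Y.V, (∀ z, H (H z) = 0) ∧ ∀ t : k, t ≠ 0 → ∃ φ : X.V ≃ₗ[k] Y.V,
    (∀ z, φ (X.E z) = Y.E (φ z)) ∧ ∀ v z, z ∈ X.F v ↔ φ z - t • H (φ z) ∈ Y.F v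

lemma Deg.isoL {X X' Y : Obj k} (h : Deg X Y) (i : Iso X' X) : Deg X' Y := by
  obtain ⟨H, h0, h1⟩ := h
  obtain ⟨ψ, i1, i2⟩ := i
  refine ⟨H, h0, fun t ht => ?_⟩
  obtain ⟨φ, h2, h3⟩ := h1 t ht
  exact ⟨ψ.trans φ, fun z => by simp [i1, h2], fun v z => by rw [i2, h3]; simp⟩

lemma Deg.isoR {X Y Y' : Obj k} (h : Deg X Y) (i : Iso Y Y') : Deg X Y' := by
  obtain ⟨H, h0, h1⟩ := h
  obtain ⟨ψ, i1, i2⟩ := i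
  refine ⟨ψ.toLinearMap ∘ₗ H ∘ₗ ψ.symm.toLinearMap, fun z => by simp [h0], fun t ht => ?_⟩
  obtain ⟨φ, h2, h3⟩ := h1 t ht
  exact ⟨φ.trans ψ, fun z => by simp [i1, h2], fun v z => by rw [h3, i2]; simp⟩

lemma Deg.sum {X Y : Obj k} (h : Deg X Y) (R : Obj k) : Deg (sum X R) (Cl.sum Y R) := by
  obtain ⟨H, h0, h1⟩ := h
  refine ⟨H.prodMap 0, fun z => Prod.ext (h0 z.1) rfl, fun t ht => ?_⟩
  obtain ⟨φ, h2, h3⟩ := h1 t ht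
  refine ⟨φ.prodCongr (LinearEquiv.refl k _), fun z => Prod.ext (h2 z.1) rfl,
    fun v z => and_congr (h3 v z.1) ?_⟩
  show z.2 ∈ R.F v ↔ z.2 - t • (0 : R.V) ∈ R.F v
  simp

end Cl

namespace Cl
open Ty
variable {k : Type} [Field k]

/-- Coordinate version: maps on `k^4`. -/
abbrev K4 (k : Type) := (k × k) × (k × k)

def mk4 (f g : K4 k → K4 k) (h1 : ∀ x y, f (x + y) = f x + f y) (h2 : ∀ (c : k) x, f (c • x) = c • f x)
    (h3 : ∀ x, g (f x) = x) (h4 : ∀ x, f (g x) = x) : K4 k ≃ₗ[k] K4 k :=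
  { toFun := f, map_add' := h1, map_smul' := h2, invFun := g, left_inv := h3, right_inv := h4 }

def H34 (k : Type) [Field k] : K4 k →ₗ[k] K4 k where
  toFun z := ((0, 0), (z.1.1 - z.1.2, 0))
  map_add' x y := by ext <;> simp; ring
  map_smul' c x := by ext <;> simp; ring

def φ34 (t : k) (ht : t ≠ 0) : K4 k ≃ₗ[k] K4 k :=
  mk4 (fun z => ((z.1.1 + z.2.1, z.1.2 + z.2.2), (t * z.2.1, t * z.2.2)))
    (fun z => ((z.1.1 - t⁻¹ * z.2.1, z.1.2 - t⁻¹ * z.2.2), (t⁻¹ * z.2.1, t⁻¹ * z.2.2)))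
    (fun x y => by ext <;> simp <;> ring) (fun c x => by ext <;> simp <;> ring)
    (fun x => by ext <;> simp <;> field_simp <;> ring) (fun x => by ext <;> simp <;> field_simp)

lemma es_lin (s : Bool) (t a b : k) : (es s (a + t * b) : k) = es s a + t * es s b := by
  cases s <;> simp [es]

lemma deg3 (s : Bool) (i h j l : ℕ) (h1 : i < h) (h2 : h < j) (h3 : j < l) :
    Deg (sum (oP k s i l) (oP k s h j)) (sum (oP k s i j) (oP k s h l)) := by
  refine ⟨H34 k, fun z => ?_, fun t ht => ⟨φ34 t ht, fun z => ?_, fun v z => ?_⟩⟩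
  · show (((0 : k), (0 : k)), ((0 : k) - 0, (0 : k))) = 0
    simp
  · obtain ⟨⟨x, y⟩, ⟨z, w⟩⟩ : K4 k := z
    show ((((es s x : k) + es s z, (es (!s) y : k) + es (!s) w), (t * (es s z : k), t * (es (!s) w : k))) : K4 k) =
      (((es s (x + z) : k), (es (!s) (y + w) : k)), ((es s (t * z) : k), (es (!s) (t * w) : k)))
    cases s <;> simp [es]
  · obtain ⟨⟨x, y⟩, ⟨z, w⟩⟩ : K4 k := z
    show (((v < i → x = 0 ∧ y = 0) ∧ (v < l → x = y)) ∧ ((v < h → z = 0 ∧ w = 0) ∧ (v < j → z = w))) ↔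
      (((v < i → (x + z) - t * 0 = 0 ∧ (y + w) - t * 0 = 0) ∧ (v < j → (x + z) - t * 0 = (y + w) - t * 0)) ∧
       ((v < h → t * z - t * ((x + z) - (y + w)) = 0 ∧ t * w - t * 0 = 0) ∧
        (v < l → t * z - t * ((x + z) - (y + w)) = t * w - t * 0)))
    grind

lemma deg4 (s : Bool) (i h j l : ℕ) (h1 : i < h) (h2 : h ≤ j) (h3 : j < l) :
    Deg (sum (oP k s i l) (sum (oS k s h) (oS k (!s) j))) (sum (oP k s i h) (oP k s j l)) := by
  refine ⟨H34 k, fun z => ?_, fun t ht => ⟨φ34 t ht, fun z => ?_, fun v z => ?_⟩⟩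
  · show (((0 : k), (0 : k)), ((0 : k) - 0, (0 : k))) = 0
    simp
  · obtain ⟨⟨x, y⟩, ⟨z, w⟩⟩ : K4 k := z
    show ((((es s x : k) + es s z, (es (!s) y : k) + es (!s) w), (t * (es s z : k), t * (es (!s) w : k))) : K4 k) =
      (((es s (x + z) : k), (es (!s) (y + w) : k)), ((es s (t * z) : k), (es (!s) (t * w) : k)))
    cases s <;> simp [es]
  · obtain ⟨⟨x, y⟩, ⟨z, w⟩⟩ : K4 k := z
    show (((v < i → x = 0 ∧ y = 0) ∧ (v < l → x = y)) ∧ ((v < h → z = 0) ∧ (v < j → w = 0))) ↔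
      (((v < i → (x + z) - t * 0 = 0 ∧ (y + w) - t * 0 = 0) ∧ (v < h → (x + z) - t * 0 = (y + w) - t * 0)) ∧
       ((v < j → t * z - t * ((x + z) - (y + w)) = 0 ∧ t * w - t * 0 = 0) ∧
        (v < l → t * z - t * ((x + z) - (y + w)) = t * w - t * 0)))
    grind

def H5 (k : Type) [Field k] : K4 k →ₗ[k] K4 k where
  toFun z := ((0, 0), (z.1.1 - z.1.2, z.1.1 - z.1.2))
  map_add' x y := by ext <;> simp <;> ring
  map_smul' c x := by ext <;> simp <;> ring

def φ5 (t : k) (ht : t ≠ 0) : K4 k ≃ₗ[k] K4 k :=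
  mk4 (fun z => ((z.1.1 + z.2.1, z.1.2), (t * z.2.1, t * z.2.2)))
    (fun z => ((z.1.1 - t⁻¹ * z.2.1, z.1.2), (t⁻¹ * z.2.1, t⁻¹ * z.2.2)))
    (fun x y => by ext <;> simp <;> ring) (fun c x => by ext <;> simp <;> ring)
    (fun x => by ext <;> simp <;> field_simp <;> ring) (fun x => by ext <;> simp <;> field_simp)

lemma deg5 (s : Bool) (i h l r : ℕ) (h1 : i < h) (h2 : h < l) (h3 : l < r) :
    Deg (sum (oP k s i l) (oP k s h r)) (sum (oP k s i h) (oP k s l r)) := by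
  refine ⟨H5 k, fun z => ?_, fun t ht => ⟨φ5 t ht, fun z => ?_, fun v z => ?_⟩⟩
  · show (((0 : k), (0 : k)), ((0 : k) - 0, (0 : k) - 0)) = 0
    simp
  · obtain ⟨⟨x, y⟩, ⟨z, w⟩⟩ : K4 k := z
    show ((((es s x : k) + es s z, (es (!s) y : k)), (t * (es s z : k), t * (es (!s) w : k))) : K4 k) =
      (((es s (x + z) : k), (es (!s) y : k)), ((es s (t * z) : k), (es (!s) (t * w) : k)))
    cases s <;> simp [es]
  · obtain ⟨⟨x, y⟩, ⟨z, w⟩⟩ : K4 k := z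
    show (((v < i → x = 0 ∧ y = 0) ∧ (v < l → x = y)) ∧ ((v < h → z = 0 ∧ w = 0) ∧ (v < r → z = w))) ↔
      (((v < i → (x + z) - t * 0 = 0 ∧ y - t * 0 = 0) ∧ (v < h → (x + z) - t * 0 = y - t * 0)) ∧
       ((v < l → t * z - t * ((x + z) - y) = 0 ∧ t * w - t * ((x + z) - y) = 0) ∧
        (v < r → t * z - t * ((x + z) - y) = t * w - t * ((x + z) - y))))
    grind

abbrev K3 (k : Type) := (k × k) × k

def mk3 (f g : K3 k → K3 k) (h1 : ∀ x y, f (x + y) = f x + f y) (h2 : ∀ (c : k) x, f (c • x) = c • f x)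
    (h3 : ∀ x, g (f x) = x) (h4 : ∀ x, f (g x) = x) : K3 k ≃ₗ[k] K3 k :=
  { toFun := f, map_add' := h1, map_smul' := h2, invFun := g, left_inv := h3, right_inv := h4 }

def H2 (k : Type) [Field k] : K3 k →ₗ[k] K3 k where
  toFun z := ((0, 0), z.1.1 - z.1.2)
  map_add' x y := by ext <;> simp; ring
  map_smul' c x := by ext <;> simp; ring

def φ2 (t : k) (ht : t ≠ 0) : K3 k ≃ₗ[k] K3 k :=
  mk3 (fun z => ((z.1.1 + z.2, z.1.2), t * z.2))
    (fun z => ((z.1.1 - t⁻¹ * z.2, z.1.2), t⁻¹ * z.2))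
    (fun x y => by ext <;> simp <;> ring) (fun c x => by ext <;> simp <;> ring)
    (fun x => by ext <;> simp <;> field_simp <;> ring) (fun x => by ext <;> simp <;> field_simp)

lemma deg2 (s : Bool) (i j l : ℕ) (h1 : i < j) (h2 : j < l) :
    Deg (sum (oP k s i l) (oS k s j)) (sum (oP k s i j) (oS k s l)) := by
  refine ⟨H2 k, fun z => ?_, fun t ht => ⟨φ2 t ht, fun z => ?_, fun v z => ?_⟩⟩
  · show (((0 : k), (0 : k)), (0 : k) - 0) = 0
    simp
  · obtain ⟨⟨x, y⟩, z⟩ : K3 k := z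
    show ((((es s x : k) + es s z, (es (!s) y : k)), (t * (es s z : k))) : K3 k) =
      (((es s (x + z) : k), (es (!s) y : k)), (es s (t * z) : k))
    cases s <;> simp [es]
  · obtain ⟨⟨x, y⟩, z⟩ : K3 k := z
    show (((v < i → x = 0 ∧ y = 0) ∧ (v < l → x = y)) ∧ (v < j → z = 0)) ↔
      (((v < i → (x + z) - t * 0 = 0 ∧ y - t * 0 = 0) ∧ (v < j → (x + z) - t * 0 = y - t * 0)) ∧
       (v < l → t * z - t * ((x + z) - y) = 0))
    grind

def H2' (k : Type) [Field k] : K3 k →ₗ[k] K3 k where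
  toFun z := ((z.2, z.2), 0)
  map_add' x y := by ext <;> simp
  map_smul' c x := by ext <;> simp

def φ2' (t : k) (ht : t ≠ 0) : K3 k ≃ₗ[k] K3 k :=
  mk3 (fun z => ((t * z.1.1, t * z.1.2), z.1.1 + z.2))
    (fun z => ((t⁻¹ * z.1.1, t⁻¹ * z.1.2), z.2 - t⁻¹ * z.1.1))
    (fun x y => by ext <;> simp <;> ring) (fun c x => by ext <;> simp <;> ring)
    (fun x => by ext <;> simp <;> field_simp <;> ring) (fun x => by ext <;> simp <;> field_simp)

lemma deg2' (s : Bool) (i j l : ℕ) (h1 : i < j) (h2 : j < l) :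
    Deg (sum (oP k s i l) (oS k s j)) (sum (oP k s j l) (oS k s i)) := by
  refine ⟨H2' k, fun z => ?_, fun t ht => ⟨φ2' t ht, fun z => ?_, fun v z => ?_⟩⟩
  · rfl
  · obtain ⟨⟨x, y⟩, z⟩ : K3 k := z
    show ((((t * (es s x : k)), t * (es (!s) y : k)), ((es s x : k) + (es s z : k))) : K3 k) =
      (((es s (t * x) : k), (es (!s) (t * y) : k)), (es s (x + z) : k))
    cases s <;> simp [es]
  · obtain ⟨⟨x, y⟩, z⟩ : K3 k := z
    show (((v < i → x = 0 ∧ y = 0) ∧ (v < l → x = y)) ∧ (v < j → z = 0)) ↔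
      (((v < j → t * x - t * (x + z) = 0 ∧ t * y - t * (x + z) = 0) ∧
        (v < l → t * x - t * (x + z) = t * y - t * (x + z))) ∧
       (v < i → (x + z) - t * 0 = 0))
    grind

def H1 (k : Type) [Field k] : k × k →ₗ[k] k × k where
  toFun z := (0, z.1)
  map_add' x y := by ext <;> simp
  map_smul' c x := by ext <;> simp

def φ1 (t : k) (ht : t ≠ 0) : (k × k) ≃ₗ[k] (k × k) :=
  { toFun := fun z => (z.1, t * z.2)
    map_add' := fun x y => by ext <;> simp; ring
    map_smul' := fun c x => by ext <;> simp; ring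
    invFun := fun z => (z.1, t⁻¹ * z.2)
    left_inv := fun x => by ext <;> simp; field_simp
    right_inv := fun x => by ext <;> simp; field_simp }

lemma deg1 (s : Bool) (i l : ℕ) (h1 : i < l) :
    Deg (oP k s i l) (sum (oS k s i) (oS k (!s) l)) := by
  refine ⟨H1 k, fun z => ?_, fun t ht => ⟨φ1 t ht, fun z => ?_, fun v z => ?_⟩⟩
  · rfl
  · obtain ⟨x, y⟩ : k × k := z
    show (((es s x : k), t * (es (!s) y : k)) : k × k) = ((es s x : k), (es (!s) (t * y) : k))
    cases s <;> simp [es]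
  · obtain ⟨x, y⟩ : k × k := z
    show ((v < i → x = 0 ∧ y = 0) ∧ (v < l → x = y)) ↔
      ((v < i → x - t * 0 = 0) ∧ (v < l → t * y - t * x = 0))
    grind

lemma mdl1 (x : Ty) : Iso (mdl k [x]) (ob k x) := zer_sum _
lemma mdl2 (x y : Ty) : Iso (mdl k [x, y]) (sum (ob k x) (ob k y)) := sum_congr (Iso.refl _) (mdl1 y)
lemma mdl3 (x y z : Ty) : Iso (mdl k [x, y, z]) (sum (ob k x) (sum (ob k y) (ob k z))) :=
  sum_congr (Iso.refl _) (mdl2 y z)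

lemma deg_mv {A B : Multiset Ty} (h : Mv A B) :
    ∃ a b : List Ty, A = a ∧ B = b ∧ Deg (mdl k a) (mdl k b) := by
  have sw : ∀ s i j, Iso (ob k (pair i j)) (oP k s i j) := fun s i j => oP_swap _ _ _ _
  have sw' : ∀ s i j, Iso (oP k s i j) (ob k (pair i j)) := fun s i j => oP_swap _ _ _ _
  have rf : ∀ X : Obj k, Iso X X := Iso.refl
  cases h with
  | m1 s i l h =>
    exact ⟨[_], [_, _], rfl, rfl, ((deg1 s i l h).isoL ((mdl1 _).trans (sw s i l))).isoR
      (mdl2 (sgn s i) (sgn (!s) l)).symm⟩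
  | m2 s i j l h h' =>
    exact ⟨[_, _], [_, _], rfl, rfl, ((deg2 s i j l h h').isoL
      ((mdl2 _ (sgn s j)).trans (sum_congr (sw s i l) (rf _)))).isoR
      ((sum_congr (sw' s i j) (rf _)).trans (mdl2 _ (sgn s l)).symm)⟩
  | m2' s i j l h h' =>
    exact ⟨[_, _], [_, _], rfl, rfl, ((deg2' s i j l h h').isoL
      ((mdl2 _ (sgn s j)).trans (sum_congr (sw s i l) (rf _)))).isoR
      ((sum_congr (sw' s j l) (rf _)).trans (mdl2 _ (sgn s i)).symm)⟩
  | m3 i h j l h1 h2 h3 =>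
    exact ⟨[_, _], [_, _], rfl, rfl, ((deg3 true i h j l h1 h2 h3).isoL
      (mdl2 (pair _ _) (pair _ _))).isoR (mdl2 (pair _ _) (pair _ _)).symm⟩
  | m4 s i t j l h1 h2 h3 =>
    exact ⟨[_, _, _], [_, _], rfl, rfl, ((deg4 s i t j l h1 h2 h3).isoL
      ((mdl3 _ (sgn s t) (sgn (!s) j)).trans (sum_congr (sw s i l) (rf _)))).isoR
      ((sum_congr (sw' s i t) (sw' s j l)).trans (mdl2 _ _).symm)⟩
  | m5 i h l r h1 h2 h3 =>
    exact ⟨[_, _], [_, _], rfl, rfl, ((deg5 true i h l r h1 h2 h3).isoL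
      (mdl2 (pair _ _) (pair _ _))).isoR (mdl2 (pair _ _) (pair _ _)).symm⟩

/-- The model of a multiset. -/
noncomputable def mM (k : Type) [Field k] (L : Multiset Ty) : Obj k := mdl k L.toList

lemma mM_coe (l : List Ty) : Iso (mM k (l : Multiset Ty)) (mdl k l) :=
  mdl_perm (Multiset.coe_eq_coe.1 (by simp))

lemma mM_add (L M : Multiset Ty) : Iso (mM k (L + M)) (sum (mM k L) (mM k M)) := by
  have : (L + M) = ((L.toList ++ M.toList : List Ty) : Multiset Ty) := by
    rw [← Multiset.coe_add]; simp
  rw [this]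
  exact (mM_coe _).trans (mdl_append _ _)

lemma deg_step {L L' : Multiset Ty} (h : Step L L') : Deg (mM k L) (mM k L') := by
  obtain ⟨A, B, R, hm, rfl, rfl⟩ := h
  obtain ⟨a, b, rfl, rfl, hd⟩ := deg_mv (k := k) hm
  exact (((hd.isoL (mM_coe a)).isoR (mM_coe b).symm).sum (mM k R)).isoL (mM_add _ _) |>.isoR (mM_add _ _).symm

end Cl

namespace Cl
open Ty
variable {k : Type} [Field k]

/-- kernel object -/
def kerO (X W : Obj k) (ρ : X.V →ₗ[k] W.V) (h : ∀ z, ρ (X.E z) = W.E (ρ z)) : Obj k where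
  V := LinearMap.ker ρ
  E := X.E.restrict (p := LinearMap.ker ρ) (q := LinearMap.ker ρ) (fun z hz => by
    rw [LinearMap.mem_ker] at hz ⊢; rw [h, hz, map_zero])
  F v := (X.F v).comap (LinearMap.ker ρ).subtype

lemma split (X W : Obj k) (ι : W.V →ₗ[k] X.V) (ρ : X.V →ₗ[k] W.V) (hρι : ∀ w, ρ (ι w) = w)
    (h : ∀ z, ρ (X.E z) = W.E (ρ z)) (h' : ∀ z, ι (W.E z) = X.E (ι z))
    (hF : ∀ v w, w ∈ W.F v → ι w ∈ X.F v) (hF' : ∀ v z, z ∈ X.F v → ρ z ∈ W.F v) :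
    Iso X (sum W (kerO X W ρ h)) := by
  let φ : X.V ≃ₗ[k] (W.V × LinearMap.ker ρ) :=
    { toFun := fun z => (ρ z, ⟨z - ι (ρ z), by simp [hρι]⟩)
      map_add' := fun x y => by
        ext
        · simp
        · simp; abel
      map_smul' := fun c x => by
        ext
        · simp
        · simp [smul_sub]
      invFun := fun p => ι p.1 + p.2
      left_inv := fun z => by simp
      right_inv := fun p => by
        have := p.2.2
        rw [LinearMap.mem_ker] at this
        ext
        · simp [hρι]
        · simp [hρι] }
  refine ⟨φ, fun z => ?_, fun v z => ?_⟩
  · refine Prod.ext (h z) (Subtype.ext ?_)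
    show X.E z - ι (ρ (X.E z)) = X.E (z - ι (ρ z))
    rw [map_sub, h, h']
  · show z ∈ X.F v ↔ (ρ z ∈ W.F v ∧ z - ι (ρ z) ∈ X.F v)
    constructor
    · intro hz
      exact ⟨hF' v z hz, (X.F v).sub_mem hz (hF _ _ (hF' v z hz))⟩
    · rintro ⟨h1, h2⟩
      have := (X.F v).add_mem h2 (hF _ _ h1)
      simpa using this

lemma exf {V : Type} [AddCommGroup V] [Module k V] (p : Submodule k V) (x : V) (hx : x ∉ p) :
    ∃ f : V →ₗ[k] k, f x = 1 ∧ ∀ z ∈ p, f z = 0 := by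
  obtain ⟨f, h1, h2⟩ := Submodule.exists_le_ker_of_notMem hx
  refine ⟨(f x)⁻¹ • f, by simp [h1], fun z hz => ?_⟩
  have : f z = 0 := h2 hz
  simp [this]

lemma classify (n : ℕ) : ∀ X : Obj k, Module.Finite k X.V → Module.finrank k X.V ≤ n →
    (∀ z, X.E (X.E z) = X.E z) → Monotone X.F → (∃ m, X.F m = ⊤) →
    ∃ l : List Ty, Valid (l : Multiset Ty) ∧ Iso X (mdl k l) := by
  induction n with
  | zero =>
    intro X hfin hn hE hmono hm
    have h0 : Module.finrank k X.V = 0 := by omega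
    have := Module.finrank_zero_iff.1 h0
    have e : X.V ≃ₗ[k] (zer k).V :=
      { toFun := fun _ => PUnit.unit, map_add' := fun _ _ => rfl, map_smul' := fun _ _ => rfl
        invFun := fun _ => 0, left_inv := fun _ => Subsingleton.elim _ _, right_inv := fun _ => rfl }
    refine ⟨[], fun i j h => by simp at h, e, fun z => rfl, fun v z => ?_⟩
    have hz : z = 0 := Subsingleton.elim _ _
    subst hz
    exact ⟨fun _ => rfl, fun _ => (X.F v).zero_mem⟩
  | succ n ih =>
    intro X hfin hn hE hmono hm
    by_cases hnt : Module.finrank k X.V ≤ n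
    · exact ih X hfin hnt hE hmono hm
    obtain ⟨m, hm⟩ := hm
    have hne : ∃ v, X.F v ≠ ⊥ := by
      refine ⟨m, fun hb => ?_⟩
      have : Module.finrank k (⊤ : Submodule k X.V) = 0 := by rw [← hm, hb]; simp
      rw [finrank_top] at this
      omega
    obtain ⟨v, hv, hvmin⟩ := minimal _ hne
    have hlow : ∀ u, u < v → X.F u = ⊥ := by
      intro u hu
      by_contra hc
      have := hvmin u hc
      omega
    have fin : ∀ (T : Ty) (ι : (ob k T).V →ₗ[k] X.V) (ρ : X.V →ₗ[k] (ob k T).V)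
      (hT : ∀ i j, T = pair i j → i < j)
      (hρι : ∀ w, ρ (ι w) = w)
      (h : ∀ z, ρ (X.E z) = (ob k T).E (ρ z)) (h' : ∀ z, ι ((ob k T).E z) = X.E (ι z))
      (hF : ∀ v w, w ∈ (ob k T).F v → ι w ∈ X.F v) (hF' : ∀ v z, z ∈ X.F v → ρ z ∈ (ob k T).F v)
      (w0 : (ob k T).V) (hw0 : w0 ≠ 0),
      ∃ l : List Ty, Valid (l : Multiset Ty) ∧ Iso X (mdl k l) := by
      intro T ι ρ hT hρι h h' hF hF' w0 hw0
      have hlt : Module.finrank k (LinearMap.ker ρ) < Module.finrank k X.V := by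
        apply Submodule.finrank_lt
        intro htop
        apply hw0
        rw [← hρι w0]
        have : ι w0 ∈ LinearMap.ker ρ := by rw [htop]; trivial
        exact this
      obtain ⟨l, hl, hi⟩ := ih (kerO X (ob k T) ρ h)
        (inferInstanceAs (Module.Finite k (LinearMap.ker ρ)))
        (by show Module.finrank k (LinearMap.ker ρ) ≤ n; omega)
        (fun z => Subtype.ext (hE z.1)) (fun a b hab z hz => hmono hab hz)
        ⟨m, by
          show (X.F m).comap (LinearMap.ker ρ).subtype = ⊤
          rw [hm]; simp⟩
      refine ⟨T :: l, ?_, (split X (ob k T) ι ρ hρι h h' hF hF').trans (sum_congr (Iso.refl _) hi)⟩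
      intro i j hp
      simp only [Multiset.mem_coe, List.mem_cons] at hp
      rcases hp with hp | hp
      · exact hT i j hp.symm
      · exact hl i j (by simpa using hp)
    by_cases hpure : ∃ e ∈ X.F v, e ≠ 0 ∧ (X.E e = e ∨ X.E e = 0)
    · obtain ⟨e, heF, he0, hE2⟩ := hpure
      obtain ⟨ψ, hψ, -⟩ := exf (⊥ : Submodule k X.V) e (by simpa using he0)
      rcases hE2 with hE2 | hE2
      · refine fin (sgn true v) (LinearMap.toSpanSingleton k X.V e) (ψ ∘ₗ X.E) (by simp) ?_ ?_ ?_ ?_ ?_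
          (1 : k) (one_ne_zero (α := k))
        · intro w
          obtain ⟨c, rfl⟩ : ∃ c : k, c = w := ⟨_, rfl⟩
          show ψ (X.E ((c : k) • e)) = c
          rw [map_smul, hE2, map_smul, hψ]
          exact mul_one (c : k)
        · intro z
          show ψ (X.E (X.E z)) = ψ (X.E z)
          rw [hE]
        · intro z
          obtain ⟨c, rfl⟩ : ∃ c : k, c = z := ⟨_, rfl⟩
          show (c : k) • e = X.E ((c : k) • e)
          rw [map_smul, hE2]
        · intro u w hw
          obtain ⟨c, rfl⟩ : ∃ c : k, c = w := ⟨_, rfl⟩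
          show (c : k) • e ∈ X.F u
          by_cases huv : u < v
          · have : (c : k) = (0 : k) := hw huv
            rw [this, zero_smul]; exact (X.F u).zero_mem
          · exact (X.F u).smul_mem _ (hmono (by omega) heF)
        · intro u z hz huv
          rw [hlow u huv] at hz
          have hz : z = 0 := hz
          rw [hz, map_zero]; rfl
      · refine fin (sgn false v) (LinearMap.toSpanSingleton k X.V e) (ψ ∘ₗ (LinearMap.id - X.E)) (by simp) ?_ ?_ ?_ ?_ ?_
          (1 : k) (one_ne_zero (α := k))
        · intro w
          obtain ⟨c, rfl⟩ : ∃ c : k, c = w := ⟨_, rfl⟩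
          show ψ ((c : k) • e - X.E ((c : k) • e)) = c
          rw [map_smul, hE2, smul_zero, sub_zero, map_smul, hψ]
          exact mul_one (c : k)
        · intro z
          show ψ (X.E z - X.E (X.E z)) = (0 : k)
          rw [hE, sub_self, map_zero]
        · intro z
          obtain ⟨c, rfl⟩ : ∃ c : k, c = z := ⟨_, rfl⟩
          show (0 : k) • e = X.E ((c : k) • e)
          rw [map_smul, hE2, zero_smul, smul_zero]
        · intro u w hw
          obtain ⟨c, rfl⟩ : ∃ c : k, c = w := ⟨_, rfl⟩
          show (c : k) • e ∈ X.F u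
          by_cases huv : u < v
          · have : (c : k) = (0 : k) := hw huv
            rw [this, zero_smul]; exact (X.F u).zero_mem
          · exact (X.F u).smul_mem _ (hmono (by omega) heF)
        · intro u z hz huv
          rw [hlow u huv] at hz
          have hz : z = 0 := hz
          rw [hz, map_zero]; rfl
    · push Not at hpure
      obtain ⟨e, heF, he0⟩ := (Submodule.ne_bot_iff _).1 hv
      obtain ⟨hp1, hp2⟩ := hpure e heF he0
      have hxv : X.E e ∉ X.F v := fun hc => (hpure _ hc hp2).1 (hE e)
      obtain ⟨j, hj, hjmin⟩ := minimal (fun j => X.E e ∈ X.F j) ⟨m, by rw [hm]; trivial⟩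
      have hvj : v < j := by
        by_contra hc
        exact hxv (hmono (by omega) hj)
      obtain ⟨Ψ, hΨ1, hΨ0⟩ := exf (X.F (j-1)) (X.E e) (fun hc => by have := hjmin _ hc; omega)
      have hΨe : Ψ e = 0 := hΨ0 _ (hmono (by omega) heF)
      refine fin (pair v j)
        ((LinearMap.toSpanSingleton k X.V (X.E e)).coprod (LinearMap.toSpanSingleton k X.V (e - X.E e)))
        ((Ψ ∘ₗ X.E).prod (- (Ψ ∘ₗ (LinearMap.id - X.E)))) ?_ ?_ ?_ ?_ ?_ ?_
          ((1 : k), (0 : k)) ?_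
      · intro i j' h
        cases h; exact hvj
      · intro w
        obtain ⟨a, b⟩ : k × k := w
        show ((Ψ (X.E (a • X.E e + b • (e - X.E e))),
          - Ψ ((a • X.E e + b • (e - X.E e)) - X.E (a • X.E e + b • (e - X.E e)))) : k × k) = (a, b)
        simp only [map_add, map_sub, map_smul, hE, hΨ1, hΨe]
        simp
      · intro z
        show ((Ψ (X.E (X.E z)), - Ψ (X.E z - X.E (X.E z))) : k × k) = (Ψ (X.E z), 0)
        simp [hE]
      · intro w
        obtain ⟨a, b⟩ : k × k := w
        show a • X.E e + (0 : k) • (e - X.E e) = X.E (a • X.E e + b • (e - X.E e))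
        simp [hE]
      · intro u w hw
        obtain ⟨a, b⟩ : k × k := w
        obtain ⟨h1, h2⟩ : (u < v → a = 0 ∧ b = 0) ∧ (u < j → a = b) := hw
        show a • X.E e + b • (e - X.E e) ∈ X.F u
        by_cases huj : u < j
        · by_cases huv : u < v
          · rw [(h1 huv).1, (h1 huv).2]; simp
          · rw [h2 huj, ← smul_add]
            apply (X.F u).smul_mem
            simpa using hmono (by omega : v ≤ u) heF
        · have hx : X.E e ∈ X.F u := hmono (by omega) hj
          exact (X.F u).add_mem ((X.F u).smul_mem _ hx) ((X.F u).smul_mem _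
            ((X.F u).sub_mem (hmono (by omega) heF) hx))
      · intro u z hz
        show (u < v → Ψ (X.E z) = 0 ∧ - Ψ (z - X.E z) = 0) ∧ (u < j → Ψ (X.E z) = - Ψ (z - X.E z))
        constructor
        · intro huv
          rw [hlow u huv] at hz
          have hz : z = 0 := hz
          simp [hz]
        · intro huj
          have := hΨ0 z (hmono (by omega) hz)
          simp [this]
      · intro h
        have : (1 : k) = 0 := congrArg (fun z : k × k => z.1) h
        exact one_ne_zero this

end Cl

namespace Cl
open Ty
variable {k : Type} [Field k]

/-- The two projections. -/
def pr (X : Obj k) (s : Bool) : X.V →ₗ[k] X.V := if s then X.E else LinearMap.id - X.E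

noncomputable def rD (X : Obj k) (v : ℕ) : ℕ := Module.finrank k (X.F v)
noncomputable def rR (X : Obj k) (s : Bool) (v : ℕ) : ℕ := Module.finrank k ((X.F v).map (pr X s))
/-- the space whose dimension is `B` -/
def spB (X : Obj k) (v w : ℕ) : Submodule k X.V :=
  (X.F v).map (pr X true) ⊔ (X.F v).map (pr X false) ⊔ X.F w
noncomputable def rB (X : Obj k) (v w : ℕ) : ℕ := Module.finrank k (spB X v w)

lemma mapF {X Y : Obj k} (φ : X.V ≃ₗ[k] Y.V)
    (h2 : ∀ v z, z ∈ X.F v ↔ φ z ∈ Y.F v) (v : ℕ) : (X.F v).map φ.toLinearMap = Y.F v := by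
  ext z
  constructor
  · rintro ⟨x, hx, rfl⟩
    exact (h2 v x).1 hx
  · intro hz
    exact ⟨φ.symm z, by rw [SetLike.mem_coe, h2]; simpa using hz, by simp⟩

lemma mapP {X Y : Obj k} (φ : X.V ≃ₗ[k] Y.V) (h1 : ∀ z, φ (X.E z) = Y.E (φ z))
    (h2 : ∀ v z, z ∈ X.F v ↔ φ z ∈ Y.F v) (s : Bool) (v : ℕ) :
    ((X.F v).map (pr X s)).map φ.toLinearMap = (Y.F v).map (pr Y s) := by
  rw [← mapF φ h2, ← Submodule.map_comp, ← Submodule.map_comp]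
  congr 1
  ext z
  cases s <;> simp [pr, h1]

lemma iso_rD {X Y : Obj k} (h : Iso X Y) (v : ℕ) : rD X v = rD Y v := by
  obtain ⟨φ, h1, h2⟩ := h
  rw [rD, rD, ← mapF φ h2]; exact (φ.finrank_map_eq _).symm

lemma iso_rR {X Y : Obj k} (h : Iso X Y) (s : Bool) (v : ℕ) : rR X s v = rR Y s v := by
  obtain ⟨φ, h1, h2⟩ := h
  rw [rR, rR, ← mapP φ h1 h2]; exact (φ.finrank_map_eq _).symm

lemma iso_rB {X Y : Obj k} (h : Iso X Y) (v w : ℕ) : rB X v w = rB Y v w := by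
  obtain ⟨φ, h1, h2⟩ := h
  have : (spB X v w).map φ.toLinearMap = spB Y v w := by
    rw [spB, spB, Submodule.map_sup, Submodule.map_sup, mapF φ h2, mapP φ h1 h2, mapP φ h1 h2]
  rw [rB, rB, ← this]; exact (φ.finrank_map_eq _).symm

lemma finrank_subprod {V W : Type} [AddCommGroup V] [Module k V] [AddCommGroup W] [Module k W]
    [Module.Finite k V] [Module.Finite k W] (p : Submodule k V) (q : Submodule k W) :
    Module.finrank k (p.prod q) = Module.finrank k p + Module.finrank k q := by
  rw [← Module.finrank_prod]
  exact LinearEquiv.finrank_eq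
    { toFun := fun z => (⟨z.1.1, z.2.1⟩, ⟨z.1.2, z.2.2⟩)
      map_add' := fun _ _ => rfl
      map_smul' := fun _ _ => rfl
      invFun := fun z => ⟨(z.1.1, z.2.1), z.1.2, z.2.2⟩
      left_inv := fun _ => rfl
      right_inv := fun _ => rfl }

lemma pr_sum (X Y : Obj k) (s : Bool) : pr (sum X Y) s = (pr X s).prodMap (pr Y s) := by
  cases s
  · rfl
  · rfl

lemma map_sum (X Y : Obj k) (s : Bool) (v : ℕ) : ((sum X Y).F v).map (pr (sum X Y) s) =
    ((X.F v).map (pr X s)).prod ((Y.F v).map (pr Y s)) := by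
  rw [pr_sum]
  exact LinearMap.prodMap_map_prod _ _ _ _

lemma sum_rD (X Y : Obj k) [Module.Finite k X.V] [Module.Finite k Y.V] (v : ℕ) :
    rD (sum X Y) v = rD X v + rD Y v := finrank_subprod _ _

lemma sum_rR (X Y : Obj k) [Module.Finite k X.V] [Module.Finite k Y.V] (s : Bool) (v : ℕ) :
    rR (sum X Y) s v = rR X s v + rR Y s v := by
  rw [rR, map_sum]
  exact finrank_subprod _ _

lemma spB_sum (X Y : Obj k) (v w : ℕ) : spB (sum X Y) v w = (spB X v w).prod (spB Y v w) := by
  rw [spB, map_sum, map_sum]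
  exact (congrArg₂ (· ⊔ ·) (Submodule.prod_sup_prod _ _ _ _) rfl).trans (Submodule.prod_sup_prod _ _ _ _)

lemma sum_rB (X Y : Obj k) [Module.Finite k X.V] [Module.Finite k Y.V] (v w : ℕ) :
    rB (sum X Y) v w = rB X v w + rB Y v w := by
  rw [rB, spB_sum]
  exact finrank_subprod _ _

instance fin_oS (s i) : Module.Finite k (oS k s i).V := inferInstanceAs (Module.Finite k k)
instance fin_oP (s i j) : Module.Finite k (oP k s i j).V := inferInstanceAs (Module.Finite k (k × k))
instance fin_ob (x) : Module.Finite k (ob k x).V := by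
  cases x
  · exact fin_oS _ _
  · exact fin_oP _ _ _
instance fin_mdl (l) : Module.Finite k (mdl k l).V := by
  induction l with
  | nil => exact inferInstanceAs (Module.Finite k PUnit)
  | cons x l ih => exact inferInstanceAs (Module.Finite k ((ob k x).V × (mdl k l).V))

/-! unit computations -/

lemma k_rank (p : Submodule k k) (x : k) (hx : x ∈ p) (h : x ≠ 0) : Module.finrank k p = 1 := by
  have : p = ⊤ := by
    rw [eq_top_iff]
    intro y _
    have := p.smul_mem (y * x⁻¹) hx
    simpa [h] using this
  rw [this]; simp

lemma k_rank0 {V : Type} [AddCommGroup V] [Module k V] (p : Submodule k V) (h : ∀ x ∈ p, x = 0) :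
    Module.finrank k p = 0 := by
  have : p = ⊥ := (Submodule.eq_bot_iff _).2 h
  rw [this]; simp

lemma kk_rank2 (p : Submodule k (k × k)) (h1 : ((1 : k), (0 : k)) ∈ p) (h2 : ((0 : k), (1 : k)) ∈ p) :
    Module.finrank k p = 2 := by
  have : p = ⊤ := by
    rw [eq_top_iff]
    rintro ⟨x, y⟩ _
    have := p.add_mem (p.smul_mem x h1) (p.smul_mem y h2)
    simpa using this
  rw [this]; simp

lemma kk_rank1 (p : Submodule k (k × k)) (e : k × k) (h1 : e ∈ p) (h0 : e ≠ 0)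
    (h2 : ∀ z ∈ p, ∃ c : k, c • e = z) : Module.finrank k p = 1 := by
  rw [finrank_eq_one_iff']
  refine ⟨⟨e, h1⟩, fun h => h0 (congrArg Subtype.val h), fun w => ?_⟩
  obtain ⟨c, hc⟩ := h2 w.1 w.2
  exact ⟨c, Subtype.ext hc⟩

lemma oS_D (s i v) : (rD (oS k s i) v : ℤ) = tD v (sgn s i) := by
  simp only [tD]
  split_ifs with h
  · have : rD (oS k s i) v = 1 :=
      k_rank ((oS k s i).F v) (1 : k) (fun h' => by omega) one_ne_zero
    rw [this]; rfl
  · have : rD (oS k s i) v = 0 := k_rank0 ((oS k s i).F v) (fun x hx => hx (by omega))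
    rw [this]; rfl

lemma pr_oS (s s' i) (z : k) : pr (oS k s i) s' z = if s = s' then z else (0 : k) := by
  cases s <;> cases s'
  · exact sub_zero z
  · rfl
  · exact sub_self z
  · rfl

lemma oS_R (s i s' v) : (rR (oS k s i) s' v : ℤ) = tR s' v (sgn s i) := by
  simp only [tR]
  split_ifs with h
  · have : rR (oS k s i) s' v = 1 :=
      k_rank (((oS k s i).F v).map (pr (oS k s i) s')) (1 : k)
        ⟨(1 : k), fun h' => by omega, (pr_oS s s' i (1 : k)).trans (if_pos h.1)⟩ one_ne_zero
    rw [this]; rfl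
  · have : rR (oS k s i) s' v = 0 := by
      refine k_rank0 (((oS k s i).F v).map (pr (oS k s i) s')) ?_
      rintro _ ⟨z, hz, rfl⟩
      refine (pr_oS (k := k) s s' i z).trans ?_
      by_cases hs : s = s'
      · exact (if_pos hs).trans (hz (by by_contra hc; exact h ⟨hs, by omega⟩))
      · exact if_neg hs
    rw [this]; rfl

lemma spB_bot (X : Obj k) (v w : ℕ) (h : X.F v = ⊥) : spB X v w = X.F w := by
  rw [spB, h]; simp

lemma spB_le (X : Obj k) (v w : ℕ) : X.F w ≤ spB X v w := le_sup_right
lemma spB_pr (X : Obj k) (v w : ℕ) (s : Bool) (z : X.V) (hz : z ∈ X.F v) :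
    pr X s z ∈ spB X v w := by
  have : (X.F v).map (pr X s) ≤ spB X v w := by
    cases s
    · exact le_trans le_sup_right le_sup_left
    · exact le_trans le_sup_left le_sup_left
  exact this ⟨z, hz, rfl⟩

lemma oS_B (s i v w) (hvw : v ≤ w) :
    (rB (oS k s i) v w : ℤ) = tD w (sgn s i) + tC v w (sgn s i) := by
  by_cases h : v < i
  · have h0 : (oS k s i).F v = ⊥ := (Submodule.eq_bot_iff _).2 (fun x hx => hx h)
    rw [rB, spB_bot _ _ _ h0]
    simp only [tC, add_zero]
    exact oS_D s i w
  · have : rB (oS k s i) v w = 1 :=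
      k_rank (spB (oS k s i) v w) (1 : k) (spB_le _ _ _ (fun h' => by omega)) one_ne_zero
    rw [this]
    simp only [tD, tC]
    rw [if_pos (by omega)]; rfl

lemma oP_bot (s i j v) (h : v < i) : (oP k s i j).F v = ⊥ :=
  (Submodule.eq_bot_iff _).2 (fun x hx => Prod.ext (hx.1 h).1 (hx.1 h).2)

lemma oP_D (s i j v) (hij : i < j) : (rD (oP k s i j) v : ℤ) = tD v (pair i j) := by
  by_cases h1 : v < i
  · have : rD (oP k s i j) v = 0 := k_rank0 ((oP k s i j).F v) (fun x hx => by
      rw [oP_bot s i j v h1] at hx; exact hx)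
    rw [this]; simp only [tD]; split_ifs <;> omega
  by_cases h2 : v < j
  · have : rD (oP k s i j) v = 1 := by
      refine kk_rank1 ((oP k s i j).F v) ((1 : k), (1 : k)) ⟨fun h => by omega, fun _ => rfl⟩
        (fun h => one_ne_zero (α := k) (congrArg Prod.fst h)) ?_
      rintro ⟨x, y⟩ ⟨-, hz⟩
      have : x = y := hz h2
      subst this
      exact ⟨x, by simp⟩
    rw [this]; simp only [tD]; split_ifs <;> omega
  · have : rD (oP k s i j) v = 2 :=
      kk_rank2 ((oP k s i j).F v) ⟨fun h => by omega, fun _ => by omega⟩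
        ⟨fun h => by omega, fun _ => by omega⟩
    rw [this]; simp only [tD]; split_ifs <;> omega

lemma pr_oP (s' i j) (z : k × k) :
    pr (oP k true i j) s' z = ((if s' then z.1 else 0, if s' then 0 else z.2) : k × k) := by
  cases s'
  · exact Prod.ext (sub_self z.1) (sub_zero z.2)
  · rfl

lemma oP_R (i j s' v) (hij : i < j) : (rR (oP k true i j) s' v : ℤ) = tR s' v (pair i j) := by
  simp only [tR]
  split_ifs with h1
  · have : rR (oP k true i j) s' v = 1 := by
      refine kk_rank1 (((oP k true i j).F v).map (pr (oP k true i j) s'))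
        (if s' then 1 else 0, if s' then 0 else 1) ?_ ?_ ?_
      · exact ⟨((1 : k), (1 : k)), ⟨fun h => by omega, fun _ => rfl⟩, pr_oP _ _ _ _⟩
      · cases s' <;> simp
      · rintro _ ⟨z, -, rfl⟩
        obtain ⟨x, y⟩ : k × k := z
        refine ⟨if s' then x else y, ?_⟩
        refine Eq.trans ?_ (pr_oP s' i j (x, y)).symm
        cases s' <;> simp
    rw [this]; rfl
  · have : rR (oP k true i j) s' v = 0 := by
      refine k_rank0 (((oP k true i j).F v).map (pr (oP k true i j) s')) ?_
      rw [oP_bot _ _ _ _ (by omega)]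
      rintro _ ⟨z, hz, rfl⟩
      have hz : z = 0 := hz
      rw [hz, map_zero]
    rw [this]; rfl

lemma oP_B (i j v w) (hij : i < j) (hvw : v ≤ w) :
    (rB (oP k true i j) v w : ℤ) = tD w (pair i j) + tC v w (pair i j) := by
  by_cases h : v < i
  · rw [rB, spB_bot _ _ _ (oP_bot _ _ _ _ h)]
    have := oP_D (k := k) true i j w hij
    rw [rD] at this
    rw [this]
    simp only [tC]
    rw [if_neg (by omega), add_zero]
  · have : rB (oP k true i j) v w = 2 := by
      have hm : (((1 : k), (1 : k)) : (oP k true i j).V) ∈ (oP k true i j).F v :=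
        ⟨fun h => by omega, fun _ => rfl⟩
      refine kk_rank2 (spB (oP k true i j) v w) ?_ ?_
      · have := spB_pr (oP k true i j) v w true _ hm
        rw [pr_oP] at this
        exact this
      · have := spB_pr (oP k true i j) v w false _ hm
        rw [pr_oP] at this
        exact this
    rw [this]; simp only [tD, tC]; split_ifs <;> omega

lemma mdl_D (l : List Ty) (hl : Valid l) (v : ℕ) : (rD (mdl k l) v : ℤ) = S (tD v) l := by
  induction l with
  | nil =>
    have : rD (mdl k []) v = 0 := k_rank0 ((mdl k []).F v) (fun x hx => rfl)
    rw [this]; simp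
  | cons x l ih =>
    have := ih (fun i j h => hl i j (by simp at h ⊢; exact Or.inr h))
    rw [mdl, sum_rD, ← Multiset.cons_coe, S_cons, ← this]
    push_cast
    congr 1
    cases x with
    | sgn s i => exact oS_D s i v
    | pair i j => exact oP_D true i j v (hl i j (by simp))

lemma mdl_R (l : List Ty) (hl : Valid l) (s : Bool) (v : ℕ) :
    (rR (mdl k l) s v : ℤ) = S (tR s v) l := by
  induction l with
  | nil =>
    have : rR (mdl k []) s v = 0 := k_rank0 (((mdl k []).F v).map _) (fun x hx => rfl)
    rw [this]; simp
  | cons x l ih =>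
    have := ih (fun i j h => hl i j (by simp at h ⊢; exact Or.inr h))
    rw [mdl, sum_rR, ← Multiset.cons_coe, S_cons, ← this]
    push_cast
    congr 1
    cases x with
    | sgn s' i => exact oS_R s' i s v
    | pair i j => exact oP_R i j s v (hl i j (by simp))

lemma mdl_B (l : List Ty) (hl : Valid l) (v w : ℕ) (hvw : v ≤ w) :
    (rB (mdl k l) v w : ℤ) = S (tD w) l + S (tC v w) l := by
  induction l with
  | nil =>
    have : rB (mdl k []) v w = 0 := k_rank0 (spB (mdl k []) v w) (fun x hx => rfl)
    rw [this]; simp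
  | cons x l ih =>
    have := ih (fun i j h => hl i j (by simp at h ⊢; exact Or.inr h))
    rw [mdl, sum_rB, ← Multiset.cons_coe, S_cons, S_cons]
    push_cast
    rw [this]
    have : (rB (ob k x) v w : ℤ) = tD w x + tC v w x := by
      cases x with
      | sgn s' i => exact oS_B s' i v w hvw
      | pair i j => exact oP_B i j v w (hl i j (by simp)) hvw
    rw [this]; ring

/-- Comparison of models from comparison of ranks. -/
lemma le_of_ranks {X Y : Obj k} {l m : List Ty} (hl : Valid l) (hm : Valid m)
    (hX : Iso X (mdl k l)) (hY : Iso Y (mdl k m))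
    (hD : ∀ v, rD X v = rD Y v) (hR : ∀ s v, rR X s v ≤ rR Y s v)
    (hB : ∀ v w, v < w → rB X v w ≤ rB Y v w) : Le (l : Multiset Ty) m := by
  have hD' : ∀ v, S (tD v) (l : Multiset Ty) = S (tD v) m := by
    intro v
    rw [← mdl_D (k := k) l hl, ← mdl_D (k := k) m hm, ← iso_rD hX, ← iso_rD hY, hD]
  have hR' : ∀ s v, S (tR s v) (l : Multiset Ty) ≤ S (tR s v) m := by
    intro s v
    rw [← mdl_R (k := k) l hl, ← mdl_R (k := k) m hm, ← iso_rR hX, ← iso_rR hY]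
    exact_mod_cast hR s v
  refine ⟨hD', hR', fun v w hvw => ?_⟩
  rcases Nat.eq_or_lt_of_le hvw with rfl | hlt
  · have h1 := RC v l hl
    have h2 := RC v m hm
    have := hD' v
    have := hR' true v
    have := hR' false v
    omega
  · have h1 := mdl_B (k := k) l hl v w hvw
    have h2 := mdl_B (k := k) m hm v w hvw
    have h3 := hB v w hlt
    rw [iso_rB hX, iso_rB hY] at h3
    have h4 := hD' w
    have h5 : (rB (mdl k l) v w : ℤ) ≤ rB (mdl k m) v w := by exact_mod_cast h3
    omega

end Cl

namespace Cl
variable {k : Type} [Field k] {N : ℕ}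

/-- vectors supported on the first `c` coordinates -/
def std (c : ℕ) : Submodule k (Fin N → k) where
  carrier := {z | ∀ j : Fin N, c ≤ (j : ℕ) → z j = 0}
  add_mem' := by intro x y hx hy j hj; simp [hx j hj, hy j hj]
  zero_mem' := by intro j hj; rfl
  smul_mem' := by intro r x hx j hj; simp [hx j hj]

lemma mem_std {c : ℕ} {z : Fin N → k} : z ∈ (std c : Submodule k (Fin N → k)) ↔
    ∀ j : Fin N, c ≤ (j : ℕ) → z j = 0 := Iff.rfl

/-- projection to the first `a` coordinates -/
def eE (a : ℕ) : (Fin N → k) →ₗ[k] (Fin N → k) where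
  toFun z i := if (i : ℕ) < a then z i else 0
  map_add' := by intro x y; ext i; by_cases h : (i : ℕ) < a <;> simp [h]
  map_smul' := by intro r x; ext i; by_cases h : (i : ℕ) < a <;> simp [h]

lemma eE_apply (a : ℕ) (z : Fin N → k) (i : Fin N) : eE a z i = if (i : ℕ) < a then z i else 0 := rfl

/-- the object of a matrix -/
def xo (a : ℕ) (c : ℕ → ℕ) (g : Matrix (Fin N) (Fin N) k) : Obj k where
  V := Fin N → k
  E := eE a
  F v := (std (c v)).map g.mulVecLin

instance (a : ℕ) (c : ℕ → ℕ) (g : Matrix (Fin N) (Fin N) k) : Module.Finite k (xo a c g).V :=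
  inferInstanceAs (Module.Finite k (Fin N → k))

def sg (k : Type) [Field k] (N : ℕ) (j : ℕ) : Fin N → k := fun i => if (i : ℕ) = j then 1 else 0

lemma std_le {c : ℕ} {W : Type} [AddCommGroup W] [Module k W] (f : (Fin N → k) →ₗ[k] W) (q : Submodule k W)
    (h : ∀ j, j < c → f (sg k N j) ∈ q) : (std c).map f ≤ q := by
  rintro _ ⟨z, hz, rfl⟩
  have : z = ∑ j : Fin N, z j • sg k N (j : ℕ) := by
    ext i
    simp [sg, Finset.sum_apply, Fin.val_inj]
  rw [this, _root_.map_sum]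
  refine Submodule.sum_mem _ fun j _ => ?_
  rw [map_smul]
  by_cases hj : (j : ℕ) < c
  · exact Submodule.smul_mem _ _ (h _ hj)
  · rw [hz j (by omega)]; simp

lemma sg_mem {c j : ℕ} (h : j < c) : sg k N j ∈ (std c : Submodule k (Fin N → k)) := by
  intro i hi
  simp [sg]; omega

lemma mulVec_sg (g : Matrix (Fin N) (Fin N) k) (j : ℕ) (i : Fin N) :
    (g *ᵥ sg k N j) i = ent g i j := by
  unfold ent
  split_ifs with h
  · have : sg k N j = Pi.single (⟨j, h.2⟩ : Fin N) 1 := by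
      ext i; simp [sg, Pi.single_apply, Fin.ext_iff]
    rw [this]; simp
  · have : sg k N j = 0 := by
      ext i'; simp [sg]; intro h'; exact h ⟨i.2, h' ▸ i'.2⟩
    rw [this]; simp

lemma rank_eq_of {m p : ℕ} (A : Matrix (Fin m) (Fin p) k) {W : Type} [AddCommGroup W] [Module k W]
    (ι : (Fin m → k) →ₗ[k] W) (hι : Function.Injective ι) (q : Submodule k W)
    (h1 : ∀ j, ι (A.col j) ∈ q) (h2 : ∀ q' : Submodule k W, (∀ j, ι (A.col j) ∈ q') → q ≤ q') :
    A.rank = Module.finrank k q := by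
  have : q = (Submodule.span k (Set.range A.col)).map ι := by
    apply le_antisymm
    · exact h2 _ fun j => ⟨_, Submodule.subset_span ⟨j, rfl⟩, rfl⟩
    · rw [Submodule.map_le_iff_le_comap, Submodule.span_le]
      rintro _ ⟨j, rfl⟩
      exact h1 j
  rw [this, Matrix.rank_eq_finrank_span_cols]
  exact LinearEquiv.finrank_eq (Submodule.equivMapOfInjective ι hι _)

def ext0 (k : Type) [Field k] (N a s : ℕ) : (Fin a → k) →ₗ[k] (Fin N → k) where
  toFun z i := if h : s ≤ (i : ℕ) ∧ (i : ℕ) - s < a then z ⟨(i : ℕ) - s, h.2⟩ else 0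
  map_add' := by intro x y; ext i; by_cases h : s ≤ (i : ℕ) ∧ (i : ℕ) - s < a <;> simp [h]
  map_smul' := by intro r x; ext i; by_cases h : s ≤ (i : ℕ) ∧ (i : ℕ) - s < a <;> simp [h]

lemma ext0_apply (a s : ℕ) (z : Fin a → k) (i : Fin N) : ext0 k N a s z i =
  if h : s ≤ (i : ℕ) ∧ (i : ℕ) - s < a then z ⟨(i : ℕ) - s, h.2⟩ else 0 := rfl

lemma ext0_inj (a s : ℕ) (h : s + a ≤ N) : Function.Injective (ext0 k N a s) := by
  intro x y hxy
  ext i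
  have := congrFun hxy ⟨s + i, by have := i.2; omega⟩
  simpa [ext0_apply] using this

lemma prT (a : ℕ) (c : ℕ → ℕ) (g : Matrix (Fin N) (Fin N) k) (z : Fin N → k) (i : Fin N) :
    (pr (xo a c g) true z : Fin N → k) i = if (i : ℕ) < a then z i else 0 := rfl

lemma prF (a : ℕ) (c : ℕ → ℕ) (g : Matrix (Fin N) (Fin N) k) (z : Fin N → k) (i : Fin N) :
    (pr (xo a c g) false z : Fin N → k) i = if (i : ℕ) < a then 0 else z i := by
  have : (pr (xo a c g) false z : Fin N → k) i = z i - if (i : ℕ) < a then z i else 0 := rfl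
  rw [this]; split_ifs <;> simp

lemma U_eq (a : ℕ) (c : ℕ → ℕ) (g : Matrix (Fin N) (Fin N) k) (ha : a ≤ N) (v : ℕ) :
    (Matrix.of fun (i : Fin a) (j : Fin (c v)) => ent g (i : ℕ) (j : ℕ)).rank
      = rR (xo a c g) true v := by
  have key : ∀ j : ℕ, ext0 k N a 0 (fun i => ent g (i : ℕ) j)
      = pr (xo a c g) true (g *ᵥ sg k N j) := by
    intro j
    ext i
    rw [prT, ext0_apply, mulVec_sg]
    simp
  refine rank_eq_of _ (ext0 k N a 0) (ext0_inj _ _ (by omega)) _ ?_ ?_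
  · intro j
    exact (key j) ▸ ⟨_, ⟨_, sg_mem j.2, rfl⟩, rfl⟩
  · intro q hq
    have : ((xo a c g).F v).map (pr (xo a c g) true) =
      (std (c v)).map ((pr (xo a c g) true) ∘ₗ g.mulVecLin) := (Submodule.map_comp _ _ _).symm
    rw [this]
    refine std_le _ _ fun j hj => ?_
    have := hq ⟨j, hj⟩
    exact (key j) ▸ this

lemma L_eq (a b : ℕ) (c : ℕ → ℕ) (g : Matrix (Fin N) (Fin N) k) (ha : a + b = N) (v : ℕ) :
    (Matrix.of fun (i : Fin b) (j : Fin (c v)) => ent g (a + (i : ℕ)) (j : ℕ)).rank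
      = rR (xo a c g) false v := by
  have key : ∀ j : ℕ, ext0 k N b a (fun i => ent g (a + (i : ℕ)) j)
      = pr (xo a c g) false (g *ᵥ sg k N j) := by
    intro j
    ext i
    rw [prF, ext0_apply, mulVec_sg]
    have := i.2
    by_cases h : (i : ℕ) < a
    · rw [if_pos h, dif_neg (by omega)]
    · rw [if_neg h, dif_pos ⟨by omega, by omega⟩]
      congr 1
      simp only; omega
  refine rank_eq_of _ (ext0 k N b a) (ext0_inj _ _ (by omega)) _ ?_ ?_
  · intro j
    exact (key j) ▸ ⟨_, ⟨_, sg_mem j.2, rfl⟩, rfl⟩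
  · intro q hq
    have : ((xo a c g).F v).map (pr (xo a c g) false) =
      (std (c v)).map ((pr (xo a c g) false) ∘ₗ g.mulVecLin) := (Submodule.map_comp _ _ _).symm
    rw [this]
    refine std_le _ _ fun j hj => ?_
    have := hq ⟨j, hj⟩
    exact (key j) ▸ this

lemma B_eq (a : ℕ) (c : ℕ → ℕ) (g : Matrix (Fin N) (Fin N) k) (v w : ℕ) (hc : c v ≤ c w) :
    (Matrix.of fun (i : Fin N) (j : Fin (c v + c v + (c w - c v))) =>
    if (j : ℕ) < c v then
      (if (i : ℕ) < a then ent g (i : ℕ) (j : ℕ) else 0)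
    else if (j : ℕ) < c v + c v then
      (if a ≤ (i : ℕ) then ent g (i : ℕ) ((j : ℕ) - c v) else 0)
    else ent g (i : ℕ) ((j : ℕ) - c v)).rank = rB (xo a c g) v w := by
  let col : ℕ → (Fin N → k) := fun j i =>
    if (j : ℕ) < c v then
      (if (i : ℕ) < a then ent g (i : ℕ) (j : ℕ) else 0)
    else if (j : ℕ) < c v + c v then
      (if a ≤ (i : ℕ) then ent g (i : ℕ) ((j : ℕ) - c v) else 0)
    else ent g (i : ℕ) ((j : ℕ) - c v)
  have k1 : ∀ j : ℕ, j < c v → col j = pr (xo a c g) true (g *ᵥ sg k N j) := by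
    intro j hj
    ext i
    rw [prT, mulVec_sg]
    simp [col, hj]
  have k2 : ∀ j : ℕ, j < c v → col (c v + j) = pr (xo a c g) false (g *ᵥ sg k N j) := by
    intro j hj
    ext i
    rw [prF, mulVec_sg]
    by_cases h : (i : ℕ) < a <;> simp [col, hj, h, not_le.2, not_lt.1]
  have k3 : ∀ j : ℕ, c v ≤ j → col (c v + j) = g *ᵥ sg k N j := by
    intro j hj
    ext i
    rw [mulVec_sg]
    simp [col, hj, not_lt.2]
  have hT : ∀ q : Submodule k (Fin N → k), (∀ j, j < c v → col j ∈ q) →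
      ((xo a c g).F v).map (pr (xo a c g) true) ≤ q := by
    intro q hq
    have : ((xo a c g).F v).map (pr (xo a c g) true) =
      (std (c v)).map ((pr (xo a c g) true) ∘ₗ g.mulVecLin) := (Submodule.map_comp _ _ _).symm
    rw [this]
    refine std_le _ _ fun j hj => ?_
    exact (k1 j hj) ▸ hq j hj
  have hF : ∀ q : Submodule k (Fin N → k), (∀ j, j < c v → col (c v + j) ∈ q) →
      ((xo a c g).F v).map (pr (xo a c g) false) ≤ q := by
    intro q hq
    have : ((xo a c g).F v).map (pr (xo a c g) false) =
      (std (c v)).map ((pr (xo a c g) false) ∘ₗ g.mulVecLin) := (Submodule.map_comp _ _ _).symm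
    rw [this]
    refine std_le _ _ fun j hj => ?_
    exact (k2 j hj) ▸ hq j hj
  refine rank_eq_of _ LinearMap.id (fun _ _ h => h) (spB (xo a c g) v w) ?_ ?_
  · intro j
    change col j ∈ spB (xo a c g) v w
    by_cases h1 : (j : ℕ) < c v
    · rw [k1 j h1]
      exact spB_pr _ v w true _ ⟨_, sg_mem h1, rfl⟩
    by_cases h2 : (j : ℕ) < c v + c v
    · have := k2 (j - c v) (by omega)
      rw [Nat.add_sub_cancel' (by omega)] at this
      rw [this]
      exact spB_pr _ v w false _ ⟨_, sg_mem (by omega), rfl⟩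
    · have := k3 (j - c v) (by omega)
      rw [Nat.add_sub_cancel' (by omega)] at this
      rw [this]
      exact spB_le _ v w ⟨_, sg_mem (by have := j.2; omega), rfl⟩
  · intro q hq
    have hq' : ∀ j, j < c v + c v + (c w - c v) → col j ∈ q := fun j hj => hq ⟨j, hj⟩
    refine sup_le (sup_le (hT q fun j hj => hq' j (by omega)) (hF q fun j hj => hq' _ (by omega))) ?_
    refine std_le _ _ fun j hj => ?_
    change g *ᵥ sg k N j ∈ q
    by_cases h : j < c v
    · have : g *ᵥ sg k N j = col j + col (c v + j) := by
        rw [k1 j h, k2 j h]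
        ext i
        refine Eq.trans ?_ (congrArg₂ (· + ·) (prT a c g _ i) (prF a c g _ i)).symm
        split_ifs <;> simp
      rw [this]
      exact q.add_mem (hq' _ (by omega)) (hq' _ (by omega))
    · rw [← k3 j (by omega)]
      exact hq' _ (by omega)

end Cl

namespace Cl
variable {k : Type} [Field k] {N : ℕ}

lemma mem_xo (a : ℕ) (c : ℕ → ℕ) (g h : Matrix (Fin N) (Fin N) k) (h1 : g * h = 1) (h2 : h * g = 1)
    (v : ℕ) (z : Fin N → k) : z ∈ (xo a c g).F v ↔ h *ᵥ z ∈ (std (c v) : Submodule k (Fin N → k)) := by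
  constructor
  · rintro ⟨x, hx, rfl⟩
    have : h *ᵥ (g *ᵥ x) = x := by rw [Matrix.mulVec_mulVec, h2, Matrix.one_mulVec]
    exact (congrArg (· ∈ (std (c v) : Submodule k (Fin N → k))) this).mpr hx
  · intro hz
    refine ⟨_, hz, ?_⟩
    change g *ᵥ (h *ᵥ z) = z
    rw [Matrix.mulVec_mulVec, h1, Matrix.one_mulVec]

lemma mem_xo_mul (a : ℕ) (c : ℕ → ℕ) (g A B : Matrix (Fin N) (Fin N) k) (h1 : A * B = 1) (h2 : B * A = 1)
    (v : ℕ) (z : Fin N → k) : z ∈ (xo a c (A * g)).F v ↔ B *ᵥ z ∈ (xo a c g).F v := by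
  constructor
  · rintro ⟨x, hx, rfl⟩
    have : B *ᵥ ((A * g) *ᵥ x) = g *ᵥ x := by
      rw [Matrix.mulVec_mulVec, ← Matrix.mul_assoc, h2, Matrix.one_mul]
    refine ⟨x, hx, ?_⟩
    exact this.symm
  · rintro ⟨x, hx, hz⟩
    refine ⟨x, hx, ?_⟩
    change (A * g) *ᵥ x = z
    have hz : g *ᵥ x = B *ᵥ z := hz
    rw [← Matrix.mulVec_mulVec, hz, Matrix.mulVec_mulVec, h1, Matrix.one_mulVec]

def isK (a : ℕ) (g : Matrix (Fin N) (Fin N) k) : Prop :=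
  IsUnit g ∧ ∀ i c : Fin N, (((i : ℕ) < a ∧ a ≤ (c : ℕ)) ∨ (a ≤ (i : ℕ) ∧ (c : ℕ) < a)) → g i c = 0

def isP (c : ℕ → ℕ) (g : Matrix (Fin N) (Fin N) k) : Prop :=
  IsUnit g ∧ ∀ (i j : Fin N) (v : ℕ), (j : ℕ) < c v → c v ≤ (i : ℕ) → g i j = 0

/-- linear equivalence of an invertible matrix -/
def leq (A B : Matrix (Fin N) (Fin N) k) (h1 : A * B = 1) (h2 : B * A = 1) :
    (Fin N → k) ≃ₗ[k] (Fin N → k) :=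
  LinearEquiv.ofLinearMap A.mulVecLin B.mulVecLin
    (by rw [← Matrix.mulVecLin_mul, h1, Matrix.mulVecLin_one])
    (by rw [← Matrix.mulVecLin_mul, h2, Matrix.mulVecLin_one])

lemma inv_pair {g : Matrix (Fin N) (Fin N) k} (h : IsUnit g) : ∃ h, g * h = 1 ∧ h * g = 1 := by
  obtain ⟨u, rfl⟩ := h
  exact ⟨(u⁻¹ : _ˣ), u.mul_inv, u.inv_mul⟩

lemma isK_comm {a : ℕ} {A : Matrix (Fin N) (Fin N) k} (h : isK a A) (z : Fin N → k) :
    A *ᵥ (eE a z) = eE a (A *ᵥ z) := by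
  ext i
  rw [eE_apply]
  simp only [Matrix.mulVec, dotProduct]
  split_ifs with hi
  · refine Finset.sum_congr rfl fun j _ => ?_
    rw [eE_apply]
    split_ifs with hj
    · rfl
    · rw [h.2 i j (Or.inl ⟨hi, by omega⟩)]; simp
  · refine Finset.sum_eq_zero fun j _ => ?_
    rw [eE_apply]
    split_ifs with hj
    · rw [h.2 i j (Or.inr ⟨by omega, hj⟩)]; simp
    · simp

lemma isK_of_comm {a : ℕ} {A : Matrix (Fin N) (Fin N) k} (hu : IsUnit A)
    (h : ∀ z, A *ᵥ (eE a z) = eE a (A *ᵥ z)) : isK a A := by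
  refine ⟨hu, fun i j hij => ?_⟩
  have := congrFun (h (Pi.single j 1)) i
  rw [eE_apply] at this
  have e1 : (eE a (Pi.single j (1 : k)) : Fin N → k) = if (j : ℕ) < a then Pi.single j 1 else 0 := by
    ext i'
    rw [eE_apply]
    by_cases hh : i' = j
    · subst hh; split_ifs <;> simp
    · split_ifs <;> simp [hh]
  rw [e1] at this
  rcases hij with ⟨h1, h2⟩ | ⟨h1, h2⟩
  · rw [if_neg (by omega), if_pos h1] at this
    simpa using this.symm
  · rw [if_pos h2, if_neg (by omega)] at this
    simpa using this

lemma isP_std {c : ℕ → ℕ} {A : Matrix (Fin N) (Fin N) k} (h : isP c A) (v : ℕ) :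
    (std (c v)).map A.mulVecLin = std (c v) := by
  obtain ⟨B, h1, h2⟩ := inv_pair h.1
  apply Submodule.eq_of_le_of_finrank_eq
  · refine std_le _ _ fun j hj i hi => ?_
    change (A *ᵥ sg k N j) i = 0
    rw [mulVec_sg]
    unfold ent
    split_ifs with hh
    · exact h.2 _ _ v hj hi
    · rfl
  · exact (leq A B h1 h2).finrank_map_eq _

lemma isP_of_std {c : ℕ → ℕ} {A : Matrix (Fin N) (Fin N) k} (hu : IsUnit A)
    (h : ∀ v z, z ∈ (std (c v) : Submodule k (Fin N → k)) → A *ᵥ z ∈ (std (c v) : Submodule k (Fin N → k))) :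
    isP c A := by
  refine ⟨hu, fun i j v hj hi => ?_⟩
  have := h v _ (sg_mem (k := k) (N := N) hj) i hi
  rw [mulVec_sg] at this
  simpa [ent] using this

lemma iso_of_KP (a : ℕ) (c : ℕ → ℕ) (g A π : Matrix (Fin N) (Fin N) k) (hA : isK a A) (hπ : isP c π) :
    Iso (xo a c g) (xo a c (A * g * π)) := by
  obtain ⟨B, h1, h2⟩ := inv_pair hA.1
  refine ⟨leq A B h1 h2, fun z => isK_comm hA z, fun v z => ?_⟩
  have e : (xo a c (A * g * π)).F v = (xo a c (A * g)).F v := by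
    change (std (c v)).map (A * g * π).mulVecLin = (std (c v)).map (A * g).mulVecLin
    rw [Matrix.mulVecLin_mul, Submodule.map_comp, isP_std hπ]
  rw [e]
  refine Iff.trans ?_ (mem_xo_mul a c g A B h1 h2 v (A *ᵥ z)).symm
  have : B *ᵥ (A *ᵥ z) = z := by
    refine (Matrix.mulVec_mulVec _ _ _).trans ?_
    rw [h2]; exact Matrix.one_mulVec _
  exact Iff.of_eq (congrArg (· ∈ (xo a c g).F v) this.symm)

lemma KP_of_iso (a : ℕ) (c : ℕ → ℕ) (g g' : Matrix (Fin N) (Fin N) k) (hg : IsUnit g) (hg' : IsUnit g')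
    (h : Iso (xo a c g) (xo a c g')) : ∃ A π, isK a A ∧ isP c π ∧ g' = A * g * π := by
  obtain ⟨φ, e1, e2⟩ := h
  obtain ⟨f, f1, f2⟩ := inv_pair hg
  obtain ⟨f', f1', f2'⟩ := inv_pair hg'
  let ψ : (Fin N → k) ≃ₗ[k] (Fin N → k) := φ
  let A := LinearMap.toMatrix' ψ.toLinearMap
  let B := LinearMap.toMatrix' ψ.symm.toLinearMap
  have hAB : A * B = 1 := by
    rw [← LinearMap.toMatrix'_comp]; simp
  have hBA : B * A = 1 := by
    rw [← LinearMap.toMatrix'_comp]; simp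
  have hAv : ∀ z, A *ᵥ z = ψ z := fun z => by
    simp [A]
  have hBv : ∀ z, B *ᵥ z = ψ.symm z := fun z => by
    simp [B]
  refine ⟨A, f * B * g', isK_of_comm (IsUnit.of_mul_eq_one _ hAB) ?_, isP_of_std ?_ ?_, ?_⟩
  · intro z
    rw [hAv, hAv]; exact e1 z
  · refine IsUnit.of_mul_eq_one (f' * A * g) ?_
    calc f * B * g' * (f' * A * g) = f * B * (g' * f') * A * g := by simp only [Matrix.mul_assoc]
      _ = f * (B * A) * g := by rw [f1']; simp only [Matrix.mul_assoc, Matrix.one_mul]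
      _ = 1 := by rw [hBA, Matrix.mul_one, f2]
  · intro v z hz
    have h3 : (g' *ᵥ z) ∈ (xo a c g').F v := ⟨z, hz, rfl⟩
    have h4 : ψ.symm (g' *ᵥ z) ∈ (xo a c g).F v := by
      refine (e2 v (ψ.symm (g' *ᵥ z))).2 ?_
      have : φ (ψ.symm (g' *ᵥ z)) = g' *ᵥ z := ψ.apply_symm_apply _
      rw [this]; exact h3
    have h5 := (mem_xo a c g f f1 f2 v _).1 h4
    rw [← hBv, Matrix.mulVec_mulVec, Matrix.mulVec_mulVec] at h5
    exact h5
  · calc g' = A * B * g' := by rw [hAB, Matrix.one_mul]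
      _ = A * (g * f) * B * g' := by rw [f1]; simp only [Matrix.mul_assoc, Matrix.one_mul, Matrix.mul_one]
      _ = _ := by simp only [Matrix.mul_assoc]

def gO (a : ℕ) (c : ℕ → ℕ) (g : Matrix (Fin N) (Fin N) k) : Set (Matrix (Fin N) (Fin N) k) :=
  {x | IsUnit x ∧ Iso (xo a c g) (xo a c x)}

lemma self_gO {a : ℕ} {c : ℕ → ℕ} {g : Matrix (Fin N) (Fin N) k} (hg : IsUnit g) : g ∈ gO a c g :=
  ⟨hg, Iso.refl _⟩

lemma sub_Zcl (T : Set (Matrix (Fin N) (Fin N) k)) : T ⊆ Zcl T := fun x hx f hf => hf x hx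

lemma Zcl_sub {S T : Set (Matrix (Fin N) (Fin N) k)} (h : S ⊆ Zcl T) : Zcl S ⊆ Zcl T :=
  fun x hx f hf => hx f fun y hy => h hy f hf

lemma gO_sub_Zcl (a : ℕ) (c : ℕ → ℕ) (g g' : Matrix (Fin N) (Fin N) k) (hg : IsUnit g)
    (h : g ∈ Zcl (gO a c g')) : gO a c g ⊆ Zcl (gO a c g') := by
  rintro x ⟨hx, hi⟩ f hf
  obtain ⟨A, π, hA, hπ, rfl⟩ := KP_of_iso a c g x hg hx hi
  let L : Fin N × Fin N → MvPolynomial (Fin N × Fin N) k := fun p =>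
    ∑ j, ∑ i, MvPolynomial.C (A p.1 i) * MvPolynomial.X (i, j) * MvPolynomial.C (π j p.2)
  have hL : ∀ y : Matrix (Fin N) (Fin N) k,
      MvPolynomial.eval (fun p => y p.1 p.2) (MvPolynomial.bind₁ L f) =
      MvPolynomial.eval (fun p => (A * y * π) p.1 p.2) f := by
    intro y
    have e : (fun p => MvPolynomial.eval (fun p => y p.1 p.2) (L p)) =
        fun p => (A * y * π) p.1 p.2 := by
      funext p
      simp [L, Matrix.mul_apply, Finset.sum_mul]
    rw [← e]
    rw [MvPolynomial.bind₁, MvPolynomial.aeval_def, MvPolynomial.eval_eval₂]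
    rw [MvPolynomial.eval₂_eq', MvPolynomial.eval_eq']
    simp
  rw [← hL]
  refine h _ fun y hy => ?_
  rw [hL]
  exact hf _ ⟨(hA.1.mul hy.1).mul hπ.1, hy.2.trans (iso_of_KP a c y A π hA hπ)⟩

lemma curve [Infinite k] (T : Set (Matrix (Fin N) (Fin N) k)) (g H : Matrix (Fin N) (Fin N) k)
    (h : ∀ t : k, t ≠ 0 → g + t • H ∈ T) : g ∈ Zcl T := by
  intro f hf
  let q : Polynomial k := MvPolynomial.eval₂ Polynomial.C
    (fun p => Polynomial.C (g p.1 p.2) + Polynomial.X * Polynomial.C (H p.1 p.2)) f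
  have hq : ∀ t, q.eval t = MvPolynomial.eval (fun p => (g + t • H) p.1 p.2) f := by
    intro t
    simp only [q, MvPolynomial.eval₂_eq', MvPolynomial.eval_eq', Polynomial.eval_finsetSum,
      Polynomial.eval_mul, Polynomial.eval_prod, Polynomial.eval_pow, Polynomial.eval_add,
      Polynomial.eval_C, Polynomial.eval_X, Matrix.add_apply, Matrix.smul_apply, smul_eq_mul]
  have h0 : q = 0 := by
    apply Polynomial.eq_zero_of_infinite_isRoot
    refine Set.Infinite.mono (s := {0}ᶜ) ?_ (Set.finite_singleton (0 : k)).infinite_compl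
    intro t ht
    change q.eval t = 0
    rw [hq]
    exact hf _ (h t ht)
  have := hq 0
  rw [h0] at this
  simpa using this.symm

lemma degen [Infinite k] (a : ℕ) (c : ℕ → ℕ) (g : Matrix (Fin N) (Fin N) k) (hg : IsUnit g) (Y : Obj k)
    (h : Deg (xo a c g) Y) : ∃ g', IsUnit g' ∧ Iso (xo a c g') Y ∧ g' ∈ Zcl (gO a c g) := by
  obtain ⟨H, hH, hφ⟩ := h
  obtain ⟨φ₁, p1, p2⟩ := hφ 1 one_ne_zero
  let φ : (Fin N → k) ≃ₗ[k] Y.V := φ₁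
  let Hm := LinearMap.toMatrix' (φ.symm.toLinearMap ∘ₗ H ∘ₗ φ.toLinearMap)
  have hHv : ∀ z, φ (Hm *ᵥ z) = H (φ z) := fun z => by
    simp [Hm]
  have hH2 : Hm * Hm = 0 := by
    rw [← LinearMap.toMatrix'_comp]
    have : (φ.symm.toLinearMap ∘ₗ H ∘ₗ φ.toLinearMap) ∘ₗ (φ.symm.toLinearMap ∘ₗ H ∘ₗ φ.toLinearMap) = 0 := by
      refine LinearMap.ext fun z => ?_; simp [hH]
    rw [this]; simp
  have u1 : ∀ t : k, (1 + t • Hm) * (1 - t • Hm) = 1 := by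
    intro t
    simp [Matrix.mul_sub, Matrix.add_mul, hH2]
  have u2 : ∀ t : k, (1 - t • Hm) * (1 + t • Hm) = 1 := by
    intro t
    simp [Matrix.mul_add, Matrix.sub_mul, hH2]
  have key : ∀ (t : k) z, φ ((1 - t • Hm) *ᵥ z) = φ z - t • H (φ z) := by
    intro t z
    rw [Matrix.sub_mulVec, map_sub, Matrix.one_mulVec, Matrix.smul_mulVec, map_smul, hHv]
  have k2 : ∀ v z, z ∈ (xo a c ((1 - Hm) * g)).F v ↔ φ z ∈ Y.F v := by
    intro v z
    have w1 := u1 1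
    have w2 := u2 1
    rw [one_smul] at w1 w2
    refine (mem_xo_mul a c g _ _ w2 w1 v z).trans ((p2 v _).trans ?_)
    have : φ₁ ((1 + Hm) *ᵥ z) - (1 : k) • H (φ₁ ((1 + Hm) *ᵥ z)) = φ z := by
      refine (key 1 _).symm.trans ?_
      refine congrArg φ ?_
      refine (Matrix.mulVec_mulVec _ _ _).trans ?_
      rw [one_smul, w2]; exact Matrix.one_mulVec _
    exact Iff.of_eq (congrArg (· ∈ Y.F v) this)
  have hu : IsUnit ((1 - Hm) * g) := by
    refine IsUnit.mul ?_ hg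
    have := IsUnit.of_mul_eq_one _ (u2 1)
    rwa [one_smul] at this
  refine ⟨(1 - Hm) * g, hu, ⟨φ, p1, k2⟩, ?_⟩
  refine curve _ _ (Hm * ((1 - Hm) * g)) fun t ht => ?_
  have e : (1 - Hm) * g + t • (Hm * ((1 - Hm) * g)) = (1 + t • Hm) * ((1 - Hm) * g) := by
    rw [Matrix.add_mul (1 : Matrix (Fin N) (Fin N) k), Matrix.one_mul, Matrix.smul_mul]
  rw [e]
  refine ⟨(IsUnit.of_mul_eq_one _ (u1 t)).mul hu, ?_⟩
  obtain ⟨φt, q1, q2⟩ := hφ t ht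
  let φ' : (Fin N → k) ≃ₗ[k] Y.V := φt
  refine ⟨φ'.trans φ.symm, fun z => ?_, fun v z => ?_⟩
  · change φ.symm (φ' (eE a z)) = eE a (φ.symm (φ' z))
    apply φ.injective
    rw [LinearEquiv.apply_symm_apply]
    refine (q1 z).trans ?_
    refine Eq.trans ?_ (p1 (φ.symm (φ' z))).symm
    have : φ₁ (φ.symm (φ' z)) = φ' z := φ.apply_symm_apply _
    rw [this]
    rfl
  · refine (q2 v z).trans ?_
    refine Iff.trans ?_ (mem_xo_mul a c _ _ _ (u1 t) (u2 t) v (φ.symm (φ' z))).symm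
    refine Iff.trans ?_ (k2 v _).symm
    rw [key, LinearEquiv.apply_symm_apply]
    exact Iff.rfl

lemma rank_factor {m p : ℕ} (A : Matrix (Fin m) (Fin p) k) :
    ∃ (B : Matrix (Fin A.rank) (Fin m) k) (C : Matrix (Fin p) (Fin A.rank) k), B * A * C = 1 := by
  let b := Module.finBasisOfFinrankEq k (LinearMap.range A.mulVecLin) (n := A.rank) rfl
  have hc : ∀ i, ∃ z, A *ᵥ z = (b i : Fin m → k) := fun i => (b i).2
  choose z hz using hc
  obtain ⟨L, hL⟩ := (LinearMap.range A.mulVecLin).subtype.exists_leftInverse_of_injective (by simp)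
  let M : (Fin m → k) →ₗ[k] (Fin A.rank → k) := b.equivFun.toLinearMap ∘ₗ L
  refine ⟨LinearMap.toMatrix' M, Matrix.of fun i j => z j i, ?_⟩
  ext i j
  have e : (LinearMap.toMatrix' M * A * Matrix.of fun i j => z j i) i j
      = (LinearMap.toMatrix' M *ᵥ (A *ᵥ z j)) i := by
    rw [Matrix.mulVec_mulVec]; rfl
  rw [e, hz]
  have : L (b j : Fin m → k) = b j := LinearMap.congr_fun hL (b j)
  simp [M, this, Matrix.one_apply, Finsupp.single_apply, eq_comm]

lemma semi {m p : ℕ} (A : Matrix (Fin m) (Fin p) (MvPolynomial (Fin N × Fin N) k))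
    (T : Set (Matrix (Fin N) (Fin N) k)) (x : Matrix (Fin N) (Fin N) k) (hx : x ∈ Zcl T) :
    ∃ y ∈ T, (A.map (MvPolynomial.eval (fun p => x p.1 p.2))).rank ≤
      (A.map (MvPolynomial.eval (fun p => y p.1 p.2))).rank := by
  obtain ⟨B, C, h⟩ := rank_factor (A.map (MvPolynomial.eval (fun p => x p.1 p.2)))
  let f : MvPolynomial (Fin N × Fin N) k := Matrix.det
    ((B.map (MvPolynomial.C : k → MvPolynomial (Fin N × Fin N) k)) * A *
      (C.map (MvPolynomial.C : k → MvPolynomial (Fin N × Fin N) k)))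
  have hf : ∀ y : Matrix (Fin N) (Fin N) k, MvPolynomial.eval (fun p => y p.1 p.2) f =
      (B * A.map (MvPolynomial.eval (fun p => y p.1 p.2)) * C).det := by
    intro y
    rw [RingHom.map_det]
    congr 1
    simp only [RingHom.mapMatrix_apply, Matrix.map_mul, Matrix.map_map]
    congr 2
    · congr 1; ext i j; simp
    · ext i j; simp
  by_contra hc
  push Not at hc
  have := hx f fun y hy => ?_
  · rw [hf, h, Matrix.det_one] at this
    exact one_ne_zero this
  · rw [hf]
    by_contra hne
    have hu : IsUnit (B * A.map (MvPolynomial.eval (fun p => y p.1 p.2)) * C) := by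
      rw [Matrix.isUnit_iff_isUnit_det]; exact isUnit_iff_ne_zero.2 hne
    have := Matrix.rank_of_isUnit _ hu
    have l1 := Matrix.rank_mul_le_left (B * A.map (MvPolynomial.eval (fun p => y p.1 p.2))) C
    have l2 := Matrix.rank_mul_le_right B (A.map (MvPolynomial.eval (fun p => y p.1 p.2)))
    have l3 := hc y hy
    rw [Fintype.card_fin] at this
    omega

end Cl

namespace Cl

lemma psum_succ (f : ℕ → ℕ) (m : ℕ) : psum f (m + 1) = psum f m + f m := Finset.sum_range_succ _ _
lemma psum_zero (f : ℕ → ℕ) : psum f 0 = 0 := rfl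
lemma eCut_succ (n : ℕ) (dx dy : ℕ → ℕ) (p q v : ℕ) :
    eCut n dx dy p q (v + 1) = eCut n dx dy p q v + blkSize n dx dy p q (v + 1) :=
  Finset.sum_range_succ _ _

lemma cut1 (n : ℕ) (dx dy : ℕ → ℕ) (p q v : ℕ) (hv : v ≤ n) :
    eCut n dx dy p q v + psum dx (n - v) = dXt dx n := by
  induction v with
  | zero => simp [eCut, blkSize, dXt, psum_succ]; omega
  | succ v ih =>
    have := ih (by omega)
    rw [eCut_succ, blkSize, if_pos (by omega)]
    have e : n - v = n - (v + 1) + 1 := by omega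
    rw [e, psum_succ] at this
    omega

lemma cut2 (n : ℕ) (dx dy : ℕ → ℕ) (p q u : ℕ) (hu : u ≤ n) :
    eCut n dx dy p q (n + 1 + u) = dXt dx n + psum dx (u + 1) := by
  induction u with
  | zero =>
    have := cut1 n dx dy p q n le_rfl
    rw [Nat.sub_self, psum_zero] at this
    rw [Nat.add_zero, eCut_succ, blkSize, if_neg (by omega), if_pos (by omega), psum_succ, psum_zero,
      Nat.sub_self]
    omega
  | succ u ih =>
    have := ih (by omega)
    rw [← Nat.add_assoc, eCut_succ, blkSize, if_neg (by omega), if_pos (by omega), psum_succ, this]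
    have e : n + 1 + u + 1 - (n + 1) = u + 1 := by omega
    rw [e]; omega

lemma cut2' (n : ℕ) (dx dy : ℕ → ℕ) (p q : ℕ) :
    eCut n dx dy p q (2 * n + 1) = 2 * dXt dx n := by
  have := cut2 n dx dy p q n le_rfl
  have e : n + 1 + n = 2 * n + 1 := by omega
  rw [e] at this
  rw [this, dXt]; omega

lemma cut3 (n : ℕ) (dx dy : ℕ → ℕ) (p q u : ℕ) (hu : u < n) :
    eCut n dx dy p q (2 * n + 2 + u) + psum dy (n - 1 - u) = 2 * dXt dx n + dYt dy n := by
  induction u with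
  | zero =>
    have := cut2' n dx dy p q
    rw [Nat.add_zero, eCut_succ, blkSize, if_neg (by omega), if_neg (by omega), if_pos (by omega), this]
    obtain ⟨m, rfl⟩ : ∃ m, n = m + 1 := ⟨n - 1, by omega⟩
    simp [dYt, psum_succ]; omega
  | succ u ih =>
    have := ih (by omega)
    rw [← Nat.add_assoc, eCut_succ, blkSize, if_neg (by omega), if_neg (by omega), if_pos (by omega)]
    have e : n - 1 - u = n - 1 - (u + 1) + 1 := by omega
    have e' : n - 1 - (2 * n + 2 + u + 1 - (2 * n + 2)) = n - 1 - (u + 1) := by omega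
    rw [e, psum_succ] at this
    rw [e']
    omega

lemma cut4 (n : ℕ) (hn : 1 ≤ n) (dx dy : ℕ → ℕ) (p q u : ℕ) :
    eCut n dx dy p q (3 * n + 2 + u) = 2 * dXt dx n + dYt dy n + p + q + psum dy u := by
  induction u with
  | zero =>
    have := cut3 n dx dy p q (n - 1) (by omega)
    rw [Nat.sub_self, psum_zero] at this
    have e : 2 * n + 2 + (n - 1) = 3 * n + 1 := by omega
    rw [e] at this
    rw [Nat.add_zero, eCut_succ, blkSize, if_neg (by omega), if_neg (by omega), if_neg (by omega),
      if_pos (by omega), psum_zero]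
    omega
  | succ u ih =>
    rw [← Nat.add_assoc, eCut_succ, ih, blkSize, if_neg (by omega), if_neg (by omega),
      if_neg (by omega), if_neg (by omega), psum_succ]
    have e : 3 * n + 2 + u + 1 - (3 * n + 3) = u := by omega
    rw [e]; omega

lemma NN_eq (n : ℕ) (dx dy : ℕ → ℕ) (p q : ℕ) :
    NN n dx dy p q = 2 * dXt dx n + 2 * dYt dy n + p + q := by
  simp only [NN, aD, bD]; omega

lemma cut_mono (n : ℕ) (dx dy : ℕ → ℕ) (p q : ℕ) : Monotone (eCut n dx dy p q) :=
  monotone_nat_of_le_succ fun v => by rw [eCut_succ]; omega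

lemma cut_top (n : ℕ) (hn : 1 ≤ n) (dx dy : ℕ → ℕ) (p q v : ℕ) (hv : 4 * n + 2 ≤ v) :
    NN n dx dy p q ≤ eCut n dx dy p q v := by
  refine le_trans ?_ (cut_mono n dx dy p q hv)
  have e : 4 * n + 2 = 3 * n + 2 + n := by omega
  rw [e, cut4 n hn, NN_eq, dYt]; omega

lemma cut_isCut (n : ℕ) (hn : 1 ≤ n) (dx dy : ℕ → ℕ) (p q v : ℕ)
    (h : eCut n dx dy p q v < NN n dx dy p q) : isCut n dx dy p q (eCut n dx dy p q v) := by
  have hv : v < 4 * n + 2 := by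
    by_contra hc
    have := cut_top n hn dx dy p q v (by omega)
    omega
  by_cases h1 : v ≤ n
  · left
    have := cut1 n dx dy p q v h1
    exact ⟨n - v, by omega, by omega⟩
  by_cases h2 : v ≤ 2 * n + 1
  · right; left
    obtain ⟨u, rfl⟩ : ∃ u, v = n + 1 + u := ⟨v - (n + 1), by omega⟩
    exact ⟨u + 1, by omega, cut2 n dx dy p q u (by omega)⟩
  by_cases h3 : v < 3 * n + 2
  · right; right; left
    obtain ⟨u, rfl⟩ : ∃ u, v = 2 * n + 2 + u := ⟨v - (2 * n + 2), by omega⟩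
    have := cut3 n dx dy p q u (by omega)
    exact ⟨n - 1 - u, by omega, by omega⟩
  · right; right; right; right
    obtain ⟨u, rfl⟩ : ∃ u, v = 3 * n + 2 + u := ⟨v - (3 * n + 2), by omega⟩
    exact ⟨u, by omega, cut4 n hn dx dy p q u⟩

lemma isCut_cut (n : ℕ) (hn : 1 ≤ n) (dx dy : ℕ → ℕ) (p q x : ℕ) (h : isCut n dx dy p q x) (hx : 0 < x) :
    ∃ v, x = eCut n dx dy p q v := by
  rcases h with ⟨m, hm, rfl⟩ | ⟨m, hm, rfl⟩ | ⟨m, hm, rfl⟩ | rfl | ⟨m, hm, rfl⟩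
  · have hm' : m ≤ n := by
      by_contra hc
      have : m = n + 1 := by omega
      subst this
      rw [dXt] at hx; omega
    have := cut1 n dx dy p q (n - m) (by omega)
    have e : n - (n - m) = m := by omega
    rw [e] at this
    exact ⟨n - m, by omega⟩
  · cases m with
    | zero =>
      have := cut1 n dx dy p q n le_rfl
      rw [Nat.sub_self, psum_zero] at this
      exact ⟨n, by rw [psum_zero]; omega⟩
    | succ u => exact ⟨_, (cut2 n dx dy p q u (by omega)).symm⟩
  · by_cases hmn : m = n
    · subst hmn
      exact ⟨_, Eq.trans (by rw [dYt]; omega) (cut2' m dx dy p q).symm⟩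
    · have := cut3 n dx dy p q (n - 1 - m) (by omega)
      have e : n - 1 - (n - 1 - m) = m := by omega
      rw [e] at this
      exact ⟨2 * n + 2 + (n - 1 - m), by omega⟩
  · exact ⟨_, (cut4 n hn dx dy p q 0).symm⟩
  · exact ⟨_, (cut4 n hn dx dy p q m).symm⟩

variable {k : Type} [Field k]

lemma pPara_iff (n : ℕ) (hn : 1 ≤ n) (dx dy : ℕ → ℕ) (p q : ℕ)
    (g : Matrix (Fin (NN n dx dy p q)) (Fin (NN n dx dy p q)) k) :
    g ∈ pPara k n dx dy p q ↔ isP (eCut n dx dy p q) g := by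
  refine and_congr_right fun _ => ⟨fun h i j v h1 h2 => ?_, fun h i j => ?_⟩
  · exact h i j ⟨_, cut_isCut n hn dx dy p q v (lt_of_le_of_lt h2 i.2), h1, h2⟩
  · rintro ⟨x, hx, h1, h2⟩
    obtain ⟨v, rfl⟩ := isCut_cut n hn dx dy p q x hx (by omega)
    exact h i j v h1 h2

lemma orbit_eq (n : ℕ) (hn : 1 ≤ n) (dx dy : ℕ → ℕ) (p q : ℕ)
    (g : Matrix (Fin (NN n dx dy p q)) (Fin (NN n dx dy p q)) k) (hg : IsUnit g) :
    orbitKP k n dx dy p q g = gO (aD n dx dy p) (eCut n dx dy p q) g := by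
  ext x
  constructor
  · rintro ⟨A, hA, π, hπ, rfl⟩
    rw [pPara_iff n hn] at hπ
    exact ⟨(hA.1.mul hg).mul hπ.1, iso_of_KP _ _ g A π hA hπ⟩
  · rintro ⟨hx, hi⟩
    obtain ⟨A, π, hA, hπ, rfl⟩ := KP_of_iso _ _ g x hg hx hi
    exact ⟨A, hA, π, (pPara_iff n hn _ _ _ _ _).2 hπ, rfl⟩

lemma Urk_eq (n : ℕ) (dx dy : ℕ → ℕ) (p q : ℕ)
    (g : Matrix (Fin (NN n dx dy p q)) (Fin (NN n dx dy p q)) k) (v : ℕ) :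
    Urk k n dx dy p q g v = rR (xo (aD n dx dy p) (eCut n dx dy p q) g) true v :=
  U_eq _ _ g (by simp only [NN]; omega) v

lemma Lrk_eq (n : ℕ) (dx dy : ℕ → ℕ) (p q : ℕ)
    (g : Matrix (Fin (NN n dx dy p q)) (Fin (NN n dx dy p q)) k) (v : ℕ) :
    Lrk k n dx dy p q g v = rR (xo (aD n dx dy p) (eCut n dx dy p q) g) false v :=
  L_eq _ (bD n dx dy q) _ g rfl v

lemma Brk_eq (n : ℕ) (dx dy : ℕ → ℕ) (p q : ℕ)
    (g : Matrix (Fin (NN n dx dy p q)) (Fin (NN n dx dy p q)) k) (v w : ℕ) (h : v ≤ w) :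
    Brk k n dx dy p q g v w = rB (xo (aD n dx dy p) (eCut n dx dy p q) g) v w :=
  B_eq _ _ g v w (cut_mono n dx dy p q h)

/-- polynomial version of `ent` -/
noncomputable def entP (k : Type) [Field k] (N i c : ℕ) : MvPolynomial (Fin N × Fin N) k :=
  if h : i < N ∧ c < N then MvPolynomial.X (⟨i, h.1⟩, ⟨c, h.2⟩) else 0

lemma eval_entP {N : ℕ} (i c : ℕ) (x : Matrix (Fin N) (Fin N) k) :
    MvPolynomial.eval (fun p => x p.1 p.2) (entP k N i c) = ent x i c := by
  unfold entP ent; split_ifs <;> simp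

lemma semi_ent {N m r : ℕ} (P : Matrix (Fin N) (Fin N) k → Matrix (Fin m) (Fin r) k)
    (A : Matrix (Fin m) (Fin r) (MvPolynomial (Fin N × Fin N) k))
    (hA : ∀ x i j, MvPolynomial.eval (fun p => x p.1 p.2) (A i j) = P x i j)
    (T : Set (Matrix (Fin N) (Fin N) k)) (x : Matrix (Fin N) (Fin N) k) (hx : x ∈ Zcl T)
    (R : ℕ) (hR : ∀ y ∈ T, (P y).rank = R) : (P x).rank ≤ R := by
  obtain ⟨y, hy, h⟩ := semi A T x hx
  have e : ∀ x, A.map (MvPolynomial.eval (fun p => x p.1 p.2)) = P x := by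
    intro x; ext i j; simp [hA]
  rw [e, e, hR y hy] at h
  exact h

lemma semi_U (n : ℕ) (dx dy : ℕ → ℕ) (p q : ℕ)
    (x : Matrix (Fin (NN n dx dy p q)) (Fin (NN n dx dy p q)) k) (v R : ℕ)
    (T : Set (Matrix (Fin (NN n dx dy p q)) (Fin (NN n dx dy p q)) k)) (hx : x ∈ Zcl T)
    (h : ∀ y ∈ T, Urk k n dx dy p q y v = R) : Urk k n dx dy p q x v ≤ R :=
  semi_ent (fun g => Matrix.of fun (i : Fin (aD n dx dy p)) (c : Fin (eCut n dx dy p q v)) =>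
    ent g (i : ℕ) (c : ℕ)) (fun i j => entP k _ i j) (fun x i j => eval_entP _ _ _) T x hx R h

lemma semi_L (n : ℕ) (dx dy : ℕ → ℕ) (p q : ℕ)
    (x : Matrix (Fin (NN n dx dy p q)) (Fin (NN n dx dy p q)) k) (v R : ℕ)
    (T : Set (Matrix (Fin (NN n dx dy p q)) (Fin (NN n dx dy p q)) k)) (hx : x ∈ Zcl T)
    (h : ∀ y ∈ T, Lrk k n dx dy p q y v = R) : Lrk k n dx dy p q x v ≤ R :=
  semi_ent (fun g => Matrix.of fun (i : Fin (bD n dx dy q)) (c : Fin (eCut n dx dy p q v)) =>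
    ent g (aD n dx dy p + (i : ℕ)) (c : ℕ)) (fun i j => entP k _ (aD n dx dy p + (i : ℕ)) j)
    (fun x i j => eval_entP _ _ _) T x hx R h

lemma semi_B (n : ℕ) (dx dy : ℕ → ℕ) (p q : ℕ)
    (x : Matrix (Fin (NN n dx dy p q)) (Fin (NN n dx dy p q)) k) (v w R : ℕ)
    (T : Set (Matrix (Fin (NN n dx dy p q)) (Fin (NN n dx dy p q)) k)) (hx : x ∈ Zcl T)
    (h : ∀ y ∈ T, Brk k n dx dy p q y v w = R) : Brk k n dx dy p q x v w ≤ R := by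
  refine semi_ent (fun g => Matrix.of fun (i : Fin (NN n dx dy p q))
      (c : Fin (eCut n dx dy p q v + eCut n dx dy p q v +
        (eCut n dx dy p q w - eCut n dx dy p q v))) =>
    if (c : ℕ) < eCut n dx dy p q v then
      (if (i : ℕ) < aD n dx dy p then ent g (i : ℕ) (c : ℕ) else 0)
    else if (c : ℕ) < eCut n dx dy p q v + eCut n dx dy p q v then
      (if aD n dx dy p ≤ (i : ℕ) then
        ent g (i : ℕ) ((c : ℕ) - eCut n dx dy p q v) else 0)
    else ent g (i : ℕ) ((c : ℕ) - eCut n dx dy p q v))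
    (fun i c => if (c : ℕ) < eCut n dx dy p q v then
      (if (i : ℕ) < aD n dx dy p then entP k _ (i : ℕ) (c : ℕ) else 0)
    else if (c : ℕ) < eCut n dx dy p q v + eCut n dx dy p q v then
      (if aD n dx dy p ≤ (i : ℕ) then
        entP k _ (i : ℕ) ((c : ℕ) - eCut n dx dy p q v) else 0)
    else entP k _ (i : ℕ) ((c : ℕ) - eCut n dx dy p q v)) (fun x i j => ?_) T x hx R h
  simp only [Matrix.of_apply]
  split_ifs <;> simp [eval_entP]

section fin
variable (a : ℕ) (c : ℕ → ℕ) {N : ℕ} (M : ℕ) (hc : Monotone c) (hM : ∀ v, M ≤ v → N ≤ c v)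

lemma F_top {a : ℕ} {c : ℕ → ℕ} {N : ℕ} {M : ℕ} (hM : ∀ v, M ≤ v → N ≤ c v)
    (g : Matrix (Fin N) (Fin N) k) (hg : IsUnit g) (v : ℕ) (hv : M ≤ v) :
    (xo a c g).F v = ⊤ := by
  obtain ⟨f, h1, h2⟩ := inv_pair hg
  refine eq_top_iff.2 fun z _ => (mem_xo a c g f h1 h2 v z).2 ?_
  intro j hj
  have := hM v hv
  have := j.2
  omega

lemma cls {a : ℕ} {c : ℕ → ℕ} {N : ℕ} {M : ℕ} (hc : Monotone c) (hM : ∀ v, M ≤ v → N ≤ c v)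
    (g : Matrix (Fin N) (Fin N) k) (hg : IsUnit g) :
    ∃ l : List Ty, Valid (l : Multiset Ty) ∧ Iso (xo a c g) (mdl k l) := by
  refine classify _ (xo a c g) inferInstance le_rfl ?_ ?_ ⟨M, F_top hM g hg M le_rfl⟩
  · intro z
    have key : ∀ z : Fin N → k, (eE a (eE a z) : Fin N → k) = eE a z := by
      intro z
      ext i
      simp only [eE_apply]
      split_ifs <;> rfl
    exact key z
  · intro v w hvw
    refine Submodule.map_mono fun z hz j hj => hz j (le_trans (hc hvw) hj)

lemma le_of {a : ℕ} {c : ℕ → ℕ} {N : ℕ} {M : ℕ} (hM : ∀ v, M ≤ v → N ≤ c v)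
    (g g' : Matrix (Fin N) (Fin N) k) (hg : IsUnit g) (hg' : IsUnit g') {l m : List Ty}
    (hl : Valid (l : Multiset Ty)) (hm : Valid (m : Multiset Ty))
    (hX : Iso (xo a c g) (mdl k l)) (hY : Iso (xo a c g') (mdl k m))
    (hR : ∀ s v, v < M + 1 → rR (xo a c g) s v ≤ rR (xo a c g') s v)
    (hB : ∀ v w, v < w → w < M + 1 → rB (xo a c g) v w ≤ rB (xo a c g') v w) :
    Le (l : Multiset Ty) (m : Multiset Ty) := by
  refine le_of_ranks hl hm hX hY ?_ ?_ ?_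
  · have : ∀ (g : Matrix (Fin N) (Fin N) k), IsUnit g → ∀ v, rD (xo a c g) v =
      Module.finrank k (std (c v) : Submodule k (Fin N → k)) := by
      intro g hg v
      obtain ⟨f, h1, h2⟩ := inv_pair hg
      exact (leq g f h1 h2).finrank_map_eq _
    intro v; rw [this g hg, this g' hg']
  · intro s v
    by_cases hv : v < M + 1
    · exact hR s v hv
    · have := hR s M (by omega)
      simp only [rR] at this ⊢
      rw [F_top hM g hg v (by omega), F_top hM g' hg' v (by omega)]
      rw [F_top hM g hg M le_rfl, F_top hM g' hg' M le_rfl] at this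
      exact this
  · intro v w hvw
    by_cases hw : w < M + 1
    · exact hB v w hvw hw
    · have : ∀ (g : Matrix (Fin N) (Fin N) k), IsUnit g → rB (xo a c g) v w = N := by
        intro g hg
        rw [rB, spB, F_top hM g hg w (by omega), sup_top_eq, finrank_top]
        exact (Module.finrank_fin_fun k)
      rw [this g hg, this g' hg']

lemma chain [Infinite k] {a : ℕ} {c : ℕ → ℕ} {N : ℕ} (g : Matrix (Fin N) (Fin N) k) (hg : IsUnit g)
    (L' L : Multiset Ty) (h : Relation.ReflTransGen Step L' L) (hi : Iso (xo a c g) (mM k L')) :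
    ∃ g', IsUnit g' ∧ Iso (xo a c g') (mM k L) ∧ g' ∈ Zcl (gO a c g) := by
  induction h with
  | refl => exact ⟨g, hg, hi, sub_Zcl _ (self_gO hg)⟩
  | tail _ hs ih =>
    obtain ⟨g1, u1, i1, z1⟩ := ih
    obtain ⟨g2, u2, i2, z2⟩ := degen a c g1 u1 _ ((deg_step hs).isoL i1)
    exact ⟨g2, u2, i2, Zcl_sub (gO_sub_Zcl a c g1 g u1 z1) z2⟩

end fin
end Cl

/-- Over an algebraically closed field: (1) `K·g·P(d*) = K·g'·P(d*)`
iff all the rank functions `U_v, L_v, B_{v,w}` agree on `g` and `g'`; (2)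
`Zcl(K·g·P(d*)) ∩ GL ⊆ Zcl(K·g'·P(d*))` iff all the rank functions at `g` are `≤` their
values at `g'`.  (Labels are indexed by `v : Fin (4n+3)` in the order
`x_n,…,x₀,x₀ˢ,…,x_nˢ,y_n,…,y₁,(y₀+y₀'),y₁ˢ,…,y_nˢ`.) -/
theorem stmt13 (k : Type) [Field k] [IsAlgClosed k] (n : ℕ) (hn : 1 ≤ n)
    (dx dy : ℕ → ℕ) (dy0 dy0' : ℕ)
    (g g' : Matrix (Fin (NN n dx dy dy0 dy0')) (Fin (NN n dx dy dy0 dy0')) k)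
    (hg : IsUnit g) (hg' : IsUnit g') :
    (orbitKP k n dx dy dy0 dy0' g = orbitKP k n dx dy dy0 dy0' g' ↔
      ((∀ v : Fin (4 * n + 3),
          Urk k n dx dy dy0 dy0' g (v : ℕ) = Urk k n dx dy dy0 dy0' g' (v : ℕ) ∧
          Lrk k n dx dy dy0 dy0' g (v : ℕ) = Lrk k n dx dy dy0 dy0' g' (v : ℕ)) ∧
        (∀ v w : Fin (4 * n + 3), (v : ℕ) < (w : ℕ) →
          Brk k n dx dy dy0 dy0' g (v : ℕ) (w : ℕ) =
            Brk k n dx dy dy0 dy0' g' (v : ℕ) (w : ℕ)))) ∧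
    ((Zcl (orbitKP k n dx dy dy0 dy0' g) ∩ {x | IsUnit x} ⊆
        Zcl (orbitKP k n dx dy dy0 dy0' g')) ↔
      ((∀ v : Fin (4 * n + 3),
          Urk k n dx dy dy0 dy0' g (v : ℕ) ≤ Urk k n dx dy dy0 dy0' g' (v : ℕ) ∧
          Lrk k n dx dy dy0 dy0' g (v : ℕ) ≤ Lrk k n dx dy dy0 dy0' g' (v : ℕ)) ∧
        (∀ v w : Fin (4 * n + 3), (v : ℕ) < (w : ℕ) →
          Brk k n dx dy dy0 dy0' g (v : ℕ) (w : ℕ) ≤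
            Brk k n dx dy dy0 dy0' g' (v : ℕ) (w : ℕ)))) := by
  have hinf : Infinite k := IsAlgClosed.instInfinite
  have hc := Cl.cut_mono n dx dy dy0 dy0'
  have hM := Cl.cut_top n hn dx dy dy0 dy0'
  have hO := Cl.orbit_eq (k := k) n hn dx dy dy0 dy0'
  rw [hO g hg, hO g' hg']
  obtain ⟨l, hl, hX⟩ := Cl.cls (a := aD n dx dy dy0) hc hM g hg
  obtain ⟨m, hm, hY⟩ := Cl.cls (a := aD n dx dy dy0) hc hM g' hg'
  have main : ∀ (x y : Matrix (Fin (NN n dx dy dy0 dy0')) (Fin (NN n dx dy dy0 dy0')) k)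
      (hx : IsUnit x) (hy : IsUnit y) (l m : List Cl.Ty)
      (hl : Cl.Valid (l : Multiset Cl.Ty)) (hm : Cl.Valid (m : Multiset Cl.Ty))
      (hX : Cl.Iso (Cl.xo (aD n dx dy dy0) (eCut n dx dy dy0 dy0') x) (Cl.mdl k l))
      (hY : Cl.Iso (Cl.xo (aD n dx dy dy0) (eCut n dx dy dy0 dy0') y) (Cl.mdl k m)),
      ((∀ v : Fin (4 * n + 3),
          Urk k n dx dy dy0 dy0' x (v : ℕ) ≤ Urk k n dx dy dy0 dy0' y (v : ℕ) ∧
          Lrk k n dx dy dy0 dy0' x (v : ℕ) ≤ Lrk k n dx dy dy0 dy0' y (v : ℕ)) ∧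
        (∀ v w : Fin (4 * n + 3), (v : ℕ) < (w : ℕ) →
          Brk k n dx dy dy0 dy0' x (v : ℕ) (w : ℕ) ≤
            Brk k n dx dy dy0 dy0' y (v : ℕ) (w : ℕ))) →
      Cl.Le (l : Multiset Cl.Ty) (m : Multiset Cl.Ty) := by
    intro x y hx hy l m hl hm hX hY ⟨h1, h2⟩
    refine Cl.le_of hM x y hx hy hl hm hX hY ?_ ?_
    · intro s v hv
      cases s
      · rw [← Cl.Lrk_eq, ← Cl.Lrk_eq]; exact (h1 ⟨v, hv⟩).2
      · rw [← Cl.Urk_eq, ← Cl.Urk_eq]; exact (h1 ⟨v, hv⟩).1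
    · intro v w hvw hw
      rw [← Cl.Brk_eq _ _ _ _ _ _ _ _ hvw.le, ← Cl.Brk_eq _ _ _ _ _ _ _ _ hvw.le]
      exact h2 ⟨v, by omega⟩ ⟨w, hw⟩ hvw
  have oU : ∀ (x y : Matrix (Fin (NN n dx dy dy0 dy0')) (Fin (NN n dx dy dy0 dy0')) k) (v : ℕ),
      y ∈ Cl.gO (aD n dx dy dy0) (eCut n dx dy dy0 dy0') x →
      Urk k n dx dy dy0 dy0' y v = Urk k n dx dy dy0 dy0' x v := by
    intro x y v h
    rw [Cl.Urk_eq, Cl.Urk_eq]; exact (Cl.iso_rR h.2 _ _).symm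
  have oL : ∀ (x y : Matrix (Fin (NN n dx dy dy0 dy0')) (Fin (NN n dx dy dy0 dy0')) k) (v : ℕ),
      y ∈ Cl.gO (aD n dx dy dy0) (eCut n dx dy dy0 dy0') x →
      Lrk k n dx dy dy0 dy0' y v = Lrk k n dx dy dy0 dy0' x v := by
    intro x y v h
    rw [Cl.Lrk_eq, Cl.Lrk_eq]; exact (Cl.iso_rR h.2 _ _).symm
  have oB : ∀ (x y : Matrix (Fin (NN n dx dy dy0 dy0')) (Fin (NN n dx dy dy0 dy0')) k) (v w : ℕ),
      v < w → y ∈ Cl.gO (aD n dx dy dy0) (eCut n dx dy dy0 dy0') x →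
      Brk k n dx dy dy0 dy0' y v w = Brk k n dx dy dy0 dy0' x v w := by
    intro x y v w hvw h
    rw [Cl.Brk_eq _ _ _ _ _ _ _ _ hvw.le, Cl.Brk_eq _ _ _ _ _ _ _ _ hvw.le]
    exact (Cl.iso_rB h.2 _ _).symm
  refine ⟨⟨?_, ?_⟩, ⟨?_, ?_⟩⟩
  · intro h
    have hs : g ∈ Cl.gO (aD n dx dy dy0) (eCut n dx dy dy0 dy0') g' := h ▸ Cl.self_gO hg
    exact ⟨fun v => ⟨oU _ _ _ hs, oL _ _ _ hs⟩, fun v w hvw => oB _ _ _ _ hvw hs⟩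
  · rintro ⟨h1, h2⟩
    have e1 := main g g' hg hg' l m hl hm hX hY
      ⟨fun v => ⟨(h1 v).1.le, (h1 v).2.le⟩, fun v w hvw => (h2 v w hvw).le⟩
    have e2 := main g' g hg' hg m l hm hl hY hX
      ⟨fun v => ⟨(h1 v).1.ge, (h1 v).2.ge⟩, fun v w hvw => (h2 v w hvw).ge⟩
    have e : l.Perm m := Multiset.coe_eq_coe.1 (Cl.eq_of_le_le hl hm e1 e2)
    have hi := (hX.trans (Cl.mdl_perm e)).trans hY.symm
    ext x
    exact ⟨fun hx => ⟨hx.1, hi.symm.trans hx.2⟩, fun hx => ⟨hx.1, hi.trans hx.2⟩⟩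
  · intro h
    have hz := h ⟨Cl.sub_Zcl _ (Cl.self_gO hg), hg⟩
    exact ⟨fun v => ⟨Cl.semi_U n dx dy dy0 dy0' g v _ _ hz fun y hy => oU _ _ _ hy,
      Cl.semi_L n dx dy dy0 dy0' g v _ _ hz fun y hy => oL _ _ _ hy⟩,
      fun v w hvw => Cl.semi_B n dx dy dy0 dy0' g v w _ _ hz fun y hy => oB _ _ _ _ hvw hy⟩
  · intro h
    have e1 := main g g' hg hg' l m hl hm hX hY h
    have hr := (Cl.reach _ _ _ hl hm e1 le_rfl).1
    obtain ⟨x, ux, ix, zx⟩ := Cl.chain g' hg' _ _ hr (hY.trans (Cl.mM_coe m).symm)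
    have hi := ix.trans ((Cl.mM_coe l).trans hX.symm)
    have hz := Cl.gO_sub_Zcl _ _ x g' ux zx ⟨hg, hi⟩
    exact fun y hy => Cl.Zcl_sub (Cl.gO_sub_Zcl _ _ g g' hg hz) hy.1
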